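/- Let d ≥ 1 and s < 0, and assume in addition s ≤ −1/2 when d = 1. Let u₀, u₁ : ℤ^d → ℂ satisfy u_j(−n) = conj(u_j(n)) for j = 0,1 and ‖(u₀,u₁)‖_{H^s×H^{s−1}} < ∞. Then for every ε > 0 there exist sequences v₀, v₁ : ℤ^d → ℂ with v_j(−n) = conj(v_j(n)) and Σ_{n∈ℤ^d}(|v₀(n)| + ⟨n⟩^{−1}|v₁(n)|) < ∞, a time t_ε ∈ (0, ε), and a solution u of the cubic NLW on [0, t_ε] with data (v₀, v₁) in the FL¹ Duhamel sense, such that ‖(v₀,v₁) − (u₀,u₁)‖_{H^s×H^{s−1}} < ε and ‖u(t_ε)‖_{H^s} > 1/ε. In particular, the cubic NLW on T^d exhibits norm inflation at every initial datum in H^s × H^{s−1}. -/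

import Mathlib

open scoped BigOperators

noncomputable section

/-- Japanese bracket `⟨n⟩ = √(1+|n|²)` for `n ∈ ℤ^d`. -/
def jap {d : ℕ} (n : Fin d → ℤ) : ℝ := Real.sqrt (1 + ∑ i, ((n i : ℝ)) ^ 2)

/-- Discrete convolution on `ℤ^d`. -/
def dconv {d : ℕ} (f g : (Fin d → ℤ) → ℂ) : (Fin d → ℤ) → ℂ :=
  fun n => ∑' m, f m * g (n - m)

/-- Triple (cubic) convolution. -/
def dcube {d : ℕ} (f : (Fin d → ℤ) → ℂ) : (Fin d → ℤ) → ℂ := dconv (dconv f f) f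

/-- `u` is a continuous map from `I` into `ℓ¹(ℤ^d)`. -/
def ContL1On {d : ℕ} (I : Set ℝ) (u : ℝ → (Fin d → ℤ) → ℂ) : Prop :=
  (∀ t ∈ I, Summable fun n => ‖u t n‖) ∧
  ∀ t ∈ I, ∀ ε > (0 : ℝ), ∃ δ > (0 : ℝ), ∀ s ∈ I, |s - t| < δ →
    (∑' n, ‖u s n - u t n‖) < ε

/-- `u` solves the cubic NLW on `I` with data `(v₀, v₁)` in the `FL¹` Duhamel sense. -/
def SolvesNLW {d : ℕ} (I : Set ℝ) (v₀ v₁ : (Fin d → ℤ) → ℂ)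
    (u : ℝ → (Fin d → ℤ) → ℂ) : Prop :=
  ContL1On I u ∧
  ∀ t ∈ I, ∀ n : Fin d → ℤ,
    u t n = (Real.cos (t * jap n) : ℂ) * v₀ n
      + ((Real.sin (t * jap n) / jap n : ℝ) : ℂ) * v₁ n
      - ∫ s in (0 : ℝ)..t,
          ((Real.sin ((t - s) * jap n) / jap n : ℝ) : ℂ) * dcube (u s) n

/-- The square of the `H^σ` norm of a sequence of Fourier coefficients. -/
def hsum {d : ℕ} (σ : ℝ) (v : (Fin d → ℤ) → ℂ) : ℝ :=
  ∑' n, (jap n) ^ (2 * σ) * ‖v n‖ ^ 2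

end

noncomputable section

open Set MeasureTheory

/-- Indices of Fourier coefficients on `𝕋^d`. -/
abbrev Freq (d : ℕ) : Type := Fin d → ℤ

/-- The change of variables `(n, m) ↦ (m, n - m)`. -/
def convEquiv (d : ℕ) : Freq d × Freq d ≃ Freq d × Freq d where
  toFun p := (p.2, p.1 - p.2)
  invFun p := (p.1 + p.2, p.1)
  left_inv p := by ext <;> simp
  right_inv p := by ext <;> simp

section Convolution

variable {d : ℕ} {f g h : Freq d → ℂ}

lemma summable_conv_prod (hf : Summable fun n => ‖f n‖) (hg : Summable fun n => ‖g n‖) :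
    Summable fun p : Freq d × Freq d => ‖f p.2‖ * ‖g (p.1 - p.2)‖ := by
  have := hf.mul_of_nonneg hg (fun _ => norm_nonneg _) (fun _ => norm_nonneg _)
  exact (convEquiv d).summable_iff.2 this

lemma summable_conv_fiber (hf : Summable fun n => ‖f n‖) (hg : Summable fun n => ‖g n‖)
    (n : Freq d) : Summable fun m => ‖f m‖ * ‖g (n - m)‖ :=
  (summable_conv_prod hf hg).prod_factor n

lemma summable_conv_fiber' (hf : Summable fun n => ‖f n‖) (hg : Summable fun n => ‖g n‖)
    (n : Freq d) : Summable fun m => f m * g (n - m) :=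
  .of_norm (by simpa using summable_conv_fiber hf hg n)

lemma norm_dconv_le_tsum (hf : Summable fun n => ‖f n‖) (hg : Summable fun n => ‖g n‖)
    (n : Freq d) : ‖dconv f g n‖ ≤ ∑' m, ‖f m‖ * ‖g (n - m)‖ := by
  have := norm_tsum_le_tsum_norm (f := fun m => f m * g (n - m))
    (by simpa using summable_conv_fiber hf hg n)
  simpa [dconv] using this

lemma summable_norm_dconv (hf : Summable fun n => ‖f n‖) (hg : Summable fun n => ‖g n‖) :
    Summable fun n => ‖dconv f g n‖ :=
  .of_nonneg_of_le (fun _ => norm_nonneg _) (norm_dconv_le_tsum hf hg)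
    (summable_conv_prod hf hg).prod

lemma tsum_norm_dconv_le (hf : Summable fun n => ‖f n‖) (hg : Summable fun n => ‖g n‖) :
    ∑' n, ‖dconv f g n‖ ≤ (∑' n, ‖f n‖) * ∑' n, ‖g n‖ := by
  have hfg := hf.mul_of_nonneg hg (fun _ => norm_nonneg _) (fun _ => norm_nonneg _)
  calc ∑' n, ‖dconv f g n‖ ≤ ∑' n, ∑' m, ‖f m‖ * ‖g (n - m)‖ :=
        (summable_norm_dconv hf hg).tsum_le_tsum (norm_dconv_le_tsum hf hg)
          (summable_conv_prod hf hg).prod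
    _ = ∑' p : Freq d × Freq d, ‖f p.2‖ * ‖g (p.1 - p.2)‖ :=
        ((summable_conv_prod hf hg).tsum_prod).symm
    _ = ∑' p : Freq d × Freq d, ‖f p.1‖ * ‖g p.2‖ :=
        (convEquiv d).tsum_eq (fun p : Freq d × Freq d => ‖f p.1‖ * ‖g p.2‖)
    _ = _ := (hf.tsum_mul_tsum hg hfg).symm

lemma norm_dconv_le_left {G : ℝ} (hf : Summable fun n => ‖f n‖) (hg : Summable fun n => ‖g n‖)
    (hG : ∀ n, ‖g n‖ ≤ G) (n : Freq d) : ‖dconv f g n‖ ≤ (∑' n, ‖f n‖) * G := by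
  refine (norm_dconv_le_tsum hf hg n).trans ?_
  rw [← tsum_mul_right]
  exact (summable_conv_fiber hf hg n).tsum_le_tsum
    (fun m => mul_le_mul_of_nonneg_left (hG _) (norm_nonneg _)) (hf.mul_right G)

lemma norm_dconv_le_right {F : ℝ} (hf : Summable fun n => ‖f n‖) (hg : Summable fun n => ‖g n‖)
    (hF : ∀ n, ‖f n‖ ≤ F) (n : Freq d) : ‖dconv f g n‖ ≤ F * ∑' n, ‖g n‖ := by
  refine (norm_dconv_le_tsum hf hg n).trans ?_
  have hg' : Summable fun m => ‖g (n - m)‖ := (Equiv.subLeft n).summable_iff.2 hg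
  have hg'' : ∑' m, ‖g (n - m)‖ = ∑' m, ‖g m‖ := (Equiv.subLeft n).tsum_eq fun m => ‖g m‖
  rw [← hg'', ← tsum_mul_left]
  exact (summable_conv_fiber hf hg n).tsum_le_tsum
    (fun m => mul_le_mul_of_nonneg_right (hF _) (norm_nonneg _)) (hg'.mul_left F)

lemma dconv_add_left (hf : Summable fun n => ‖f n‖) (hg : Summable fun n => ‖g n‖)
    (hh : Summable fun n => ‖h n‖) : dconv (f + g) h = dconv f h + dconv g h := by
  ext n
  simp only [dconv, Pi.add_apply, add_mul]
  exact (summable_conv_fiber' hf hh n).tsum_add (summable_conv_fiber' hg hh n)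

lemma dconv_add_right (hf : Summable fun n => ‖f n‖) (hg : Summable fun n => ‖g n‖)
    (hh : Summable fun n => ‖h n‖) : dconv h (f + g) = dconv h f + dconv h g := by
  ext n
  simp only [dconv, Pi.add_apply, mul_add]
  exact (summable_conv_fiber' hh hf n).tsum_add (summable_conv_fiber' hh hg n)

end Convolution

/-- The space `ℓ¹(ℤ^d)`. -/
abbrev L1 (d : ℕ) : Type := lp (fun _ : Freq d => ℂ) 1

namespace L1

variable {d : ℕ}

lemma summable_norm (x : L1 d) : Summable fun n => ‖x n‖ := by
  simpa using (lp.memℓp x).summable (by simp)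

lemma norm_eq_tsum (x : L1 d) : ‖x‖ = ∑' n, ‖x n‖ := by
  simpa using lp.norm_eq_tsum_rpow (p := 1) (by simp) x

lemma norm_apply_le (x : L1 d) (n : Freq d) : ‖x n‖ ≤ ‖x‖ :=
  lp.norm_apply_le_norm (by simp) x n

/-- The element of `ℓ¹` given by an absolutely summable family. -/
def ofSummable (f : Freq d → ℂ) (hf : Summable fun n => ‖f n‖) : L1 d :=
  ⟨f, memℓp_gen (by simpa using hf)⟩

@[simp] lemma ofSummable_apply (f : Freq d → ℂ) (hf : Summable fun n => ‖f n‖) (n : Freq d) :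
    ofSummable f hf n = f n := rfl

/-- Convolution as a continuous bilinear map on `ℓ¹`. -/
def conv : L1 d →L[ℝ] L1 d →L[ℝ] L1 d :=
  LinearMap.mkContinuous₂
    (LinearMap.mk₂ ℝ
      (fun x y => ofSummable (dconv x y) (summable_norm_dconv x.summable_norm y.summable_norm))
      (fun x x' y => lp.ext
        (dconv_add_left x.summable_norm x'.summable_norm y.summable_norm))
      (fun c x y => lp.ext (funext fun n => by
        change ∑' m, ((c : ℝ) • x m) * y (n - m) = (c : ℝ) • ∑' m, x m * y (n - m)
        simp [← tsum_mul_left, mul_assoc]))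
      (fun x y y' => lp.ext
        (dconv_add_right y.summable_norm y'.summable_norm x.summable_norm))
      (fun c x y => lp.ext (funext fun n => by
        change ∑' m, x m * ((c : ℝ) • y (n - m)) = (c : ℝ) • ∑' m, x m * y (n - m)
        simp [← tsum_mul_left, mul_left_comm])))
    1 (fun x y => by
      simp only [LinearMap.mk₂_apply, norm_eq_tsum, one_mul]
      exact tsum_norm_dconv_le x.summable_norm y.summable_norm)

lemma norm_conv_le (x y : L1 d) : ‖conv x y‖ ≤ ‖x‖ * ‖y‖ := by
  simp only [norm_eq_tsum]
  exact tsum_norm_dconv_le x.summable_norm y.summable_norm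

/-- The trilinear convolution `x ⋆ y ⋆ z`. -/
def tri (x y z : L1 d) : L1 d := conv (conv x y) z

lemma norm_tri_le (x y z : L1 d) : ‖tri x y z‖ ≤ ‖x‖ * ‖y‖ * ‖z‖ :=
  (norm_conv_le _ _).trans (mul_le_mul_of_nonneg_right (norm_conv_le _ _) (norm_nonneg _))

lemma coe_tri_self (x : L1 d) : ⇑(tri x x x) = dcube x := rfl

lemma continuous_tri_self : Continuous fun x : L1 d => tri x x x := by
  unfold tri; fun_prop

lemma tri_sub_tri (x y : L1 d) :
    tri x x x - tri y y y = tri (x - y) x x + tri y (x - y) x + tri y y (x - y) := by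
  simp only [tri, map_sub, sub_apply]; abel

lemma norm_tri_apply_le₁ {X : ℝ} (x y z : L1 d) (hx : ∀ n, ‖x n‖ ≤ X) (n : Freq d) :
    ‖tri x y z n‖ ≤ X * ‖y‖ * ‖z‖ := by
  rw [norm_eq_tsum y, norm_eq_tsum z]
  exact norm_dconv_le_right (conv x y).summable_norm z.summable_norm
    (norm_dconv_le_right x.summable_norm y.summable_norm hx) n

lemma norm_tri_apply_le₂ {Y : ℝ} (x y z : L1 d) (hy : ∀ n, ‖y n‖ ≤ Y) (n : Freq d) :
    ‖tri x y z n‖ ≤ ‖x‖ * Y * ‖z‖ := by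
  rw [norm_eq_tsum x, norm_eq_tsum z]
  exact norm_dconv_le_right (conv x y).summable_norm z.summable_norm
    (norm_dconv_le_left x.summable_norm y.summable_norm hy) n

lemma norm_tri_apply_le₃ {Z : ℝ} (x y z : L1 d) (hz : ∀ n, ‖z n‖ ≤ Z) (n : Freq d) :
    ‖tri x y z n‖ ≤ ‖x‖ * ‖y‖ * Z := by
  have hZ : 0 ≤ Z := (norm_nonneg _).trans (hz 0)
  refine (norm_dconv_le_left (conv x y).summable_norm z.summable_norm hz n).trans ?_
  rw [← norm_eq_tsum]
  exact mul_le_mul_of_nonneg_right (norm_conv_le _ _) hZ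

/-- Evaluation at a frequency. -/
def eval (n : Freq d) : L1 d →L[ℝ] ℂ :=
  LinearMap.mkContinuous
    { toFun := fun x => x n
      map_add' := fun _ _ => rfl
      map_smul' := fun _ _ => rfl }
    1 (fun x => by rw [one_mul]; exact norm_apply_le x n)

@[simp] lemma eval_apply (n : Freq d) (x : L1 d) : eval n x = x n := rfl

lemma norm_clip_mul_le (c : ℝ) (z : ℂ) : ‖((max (-1) (min 1 c) : ℝ) : ℂ) * z‖ ≤ ‖z‖ := by
  rw [norm_mul, Complex.norm_real, Real.norm_eq_abs]
  exact mul_le_of_le_one_left (norm_nonneg _)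
    (abs_le.2 ⟨le_max_left _ _, max_le (by norm_num) (min_le_left _ _)⟩)

/-- The Fourier multiplier with symbol `m` clipped to `[-1, 1]`. -/
def mult (m : Freq d → ℝ) : L1 d →L[ℝ] L1 d :=
  LinearMap.mkContinuous
    { toFun := fun x => ofSummable (fun n => ((max (-1) (min 1 (m n)) : ℝ) : ℂ) * x n)
        (.of_nonneg_of_le (fun _ => norm_nonneg _) (fun _ => norm_clip_mul_le _ _)
          x.summable_norm)
      map_add' := fun x y => lp.ext (funext fun n => mul_add _ (x n) (y n))
      map_smul' := fun c x => lp.ext (funext fun n => mul_smul_comm c _ (x n)) }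
    1 (fun x => by
      simp only [LinearMap.coe_mk, AddHom.coe_mk, norm_eq_tsum, one_mul, ofSummable_apply]
      exact Summable.tsum_le_tsum (fun _ => norm_clip_mul_le _ _)
        (.of_nonneg_of_le (fun _ => norm_nonneg _) (fun _ => norm_clip_mul_le _ _)
          x.summable_norm) x.summable_norm)

lemma mult_apply {m : Freq d → ℝ} (hm : ∀ n, |m n| ≤ 1) (x : L1 d) (n : Freq d) :
    mult m x n = (m n : ℂ) * x n := by
  change ((max (-1) (min 1 (m n)) : ℝ) : ℂ) * x n = _
  rw [min_eq_right (abs_le.1 (hm n)).2, max_eq_right (abs_le.1 (hm n)).1]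

lemma norm_mult_le_of_le {m : Freq d → ℝ} {c : ℝ} (hm : ∀ n, |m n| ≤ 1) (hc : ∀ n, |m n| ≤ c)
    (x : L1 d) : ‖mult m x‖ ≤ c * ‖x‖ := by
  rw [norm_eq_tsum, norm_eq_tsum, ← tsum_mul_left]
  refine Summable.tsum_le_tsum (fun n => ?_) (mult m x).summable_norm (x.summable_norm.mul_left c)
  rw [mult_apply hm, norm_mul, Complex.norm_real, Real.norm_eq_abs]
  exact mul_le_mul_of_nonneg_right (hc n) (norm_nonneg _)

lemma continuous_mult {m : ℝ → Freq d → ℝ} (hm : ∀ t n, |m t n| ≤ 1)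
    (hc : ∀ n, Continuous fun t => m t n) {y : ℝ → L1 d} (hy : Continuous y) :
    Continuous fun t => mult (m t) (y t) := by
  have key : ∀ x : L1 d, Continuous fun t => mult (m t) x := by
    intro x
    rw [continuous_iff_continuousAt]
    intro t₀
    rw [ContinuousAt, tendsto_iff_norm_sub_tendsto_zero]
    have h0 : (0 : ℝ) = ∑' n : Freq d, ‖((m t₀ n - m t₀ n : ℝ) : ℂ) * x n‖ := by simp
    have heq : ∀ t, ‖mult (m t) x - mult (m t₀) x‖
        = ∑' n : Freq d, ‖((m t n - m t₀ n : ℝ) : ℂ) * x n‖ := by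
      intro t
      rw [norm_eq_tsum]
      refine tsum_congr fun n => ?_
      rw [lp.coeFn_sub, Pi.sub_apply, mult_apply (hm t), mult_apply (hm t₀)]
      push_cast
      rw [sub_mul]
    simp_rw [heq]
    rw [h0]
    refine tendsto_tsum_of_dominated_convergence (bound := fun n => 2 * ‖x n‖)
      (x.summable_norm.mul_left 2) (fun n => ?_) (Filter.Eventually.of_forall fun t n => ?_)
    · have := hc n
      exact ((Continuous.norm (by fun_prop)).tendsto t₀ :
        Filter.Tendsto (fun t => ‖((m t n - m t₀ n : ℝ) : ℂ) * x n‖) _ _)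
    · rw [norm_norm, norm_mul, Complex.norm_real, Real.norm_eq_abs]
      refine mul_le_mul_of_nonneg_right ?_ (norm_nonneg _)
      have := abs_sub (m t n) (m t₀ n)
      linarith [hm t n, hm t₀ n]
  rw [continuous_iff_continuousAt]
  intro t₀
  have h1 : Filter.Tendsto (fun t => mult (m t) (y t - y t₀)) (nhds t₀) (nhds 0) := by
    have h2 : Filter.Tendsto (fun t => ‖y t - y t₀‖) (nhds t₀) (nhds 0) :=
      tendsto_iff_norm_sub_tendsto_zero.1 hy.continuousAt
    refine squeeze_zero_norm (fun t => ?_) h2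
    simpa using norm_mult_le_of_le (hm t) (hm t) (y t - y t₀)
  have h3 := h1.add ((key (y t₀)).tendsto t₀)
  simpa [ContinuousAt, map_sub] using h3

end L1

section Jap

variable {d : ℕ}

lemma one_le_jap (n : Freq d) : 1 ≤ jap n := by
  rw [jap, Real.one_le_sqrt]
  linarith [Finset.sum_nonneg (s := Finset.univ) fun i _ => sq_nonneg ((n i : ℝ))]

lemma jap_pos (n : Freq d) : 0 < jap n := one_pos.trans_le (one_le_jap n)

lemma abs_cos_jap_le (t : ℝ) (n : Freq d) : |Real.cos (t * jap n)| ≤ 1 := Real.abs_cos_le_one _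

lemma abs_sin_div_jap_le (t : ℝ) (n : Freq d) : |Real.sin (t * jap n) / jap n| ≤ |t| := by
  rw [abs_div, abs_of_pos (jap_pos n), div_le_iff₀ (jap_pos n)]
  calc |Real.sin (t * jap n)| ≤ |t * jap n| := Real.abs_sin_le_abs
    _ = |t| * jap n := by rw [abs_mul, abs_of_pos (jap_pos n)]

lemma abs_sin_div_jap_le_one (t : ℝ) (n : Freq d) : |Real.sin (t * jap n) / jap n| ≤ 1 := by
  rw [abs_div, abs_of_pos (jap_pos n), div_le_iff₀ (jap_pos n), one_mul]
  exact (Real.abs_sin_le_one _).trans (one_le_jap n)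

end Jap

namespace L1

variable {d : ℕ}

/-- The propagator `cos(t⟨∇⟩)`. -/
def cosM (t : ℝ) : L1 d →L[ℝ] L1 d := mult fun n => Real.cos (t * jap n)

/-- The propagator `sin(t⟨∇⟩)/⟨∇⟩`. -/
def sinM (t : ℝ) : L1 d →L[ℝ] L1 d := mult fun n => Real.sin (t * jap n) / jap n

lemma cosM_apply (t : ℝ) (x : L1 d) (n : Freq d) :
    cosM t x n = (Real.cos (t * jap n) : ℂ) * x n := by
  rw [cosM, mult_apply (abs_cos_jap_le t)]

lemma sinM_apply (t : ℝ) (x : L1 d) (n : Freq d) :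
    sinM t x n = ((Real.sin (t * jap n) / jap n : ℝ) : ℂ) * x n := by
  rw [sinM, mult_apply (abs_sin_div_jap_le_one t)]

lemma norm_cosM_le (t : ℝ) (x : L1 d) : ‖cosM t x‖ ≤ ‖x‖ := by
  simpa [cosM] using norm_mult_le_of_le (abs_cos_jap_le t) (abs_cos_jap_le t) x

lemma norm_sinM_le (t : ℝ) (x : L1 d) : ‖sinM t x‖ ≤ |t| * ‖x‖ :=
  norm_mult_le_of_le (abs_sin_div_jap_le_one t) (abs_sin_div_jap_le t) x

lemma continuous_cosM {y : ℝ → L1 d} (hy : Continuous y) : Continuous fun t => cosM t (y t) :=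
  continuous_mult abs_cos_jap_le (fun n => by fun_prop) hy

lemma continuous_sinM {y : ℝ → L1 d} (hy : Continuous y) : Continuous fun t => sinM t (y t) :=
  continuous_mult abs_sin_div_jap_le_one (fun n => by fun_prop) hy

/-- The solution in terms of the interaction-picture unknowns. -/
def fromProfile (T t : ℝ) (p : L1 d × L1 d) : L1 d := cosM t p.1 + T⁻¹ • sinM t p.2

lemma fromProfile_sub (T t : ℝ) (p q : L1 d × L1 d) :
    fromProfile T t (p - q) = fromProfile T t p - fromProfile T t q := by
  simp only [fromProfile, Prod.fst_sub, Prod.snd_sub, map_sub, smul_sub]; abel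

lemma norm_fromProfile_le {T t : ℝ} (hT : 0 < T) (ht : t ∈ Icc 0 T) (p : L1 d × L1 d) :
    ‖fromProfile T t p‖ ≤ 2 * ‖p‖ := by
  have h1 : ‖cosM t p.1‖ ≤ ‖p‖ := (norm_cosM_le _ _).trans (norm_fst_le p)
  have h2 : ‖T⁻¹ • sinM t p.2‖ ≤ ‖p‖ := by
    rw [norm_smul, norm_inv, Real.norm_eq_abs, abs_of_pos hT, inv_mul_le_iff₀ hT]
    refine (norm_sinM_le _ _).trans ?_
    rw [abs_of_nonneg ht.1]
    exact mul_le_mul ht.2 (norm_snd_le p) (norm_nonneg _) hT.le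
  calc _ ≤ ‖cosM t p.1‖ + ‖T⁻¹ • sinM t p.2‖ := norm_add_le _ _
    _ ≤ _ := by linarith

lemma continuous_fromProfile (T : ℝ) {p : ℝ → L1 d × L1 d} (hp : Continuous p) :
    Continuous fun t => fromProfile T t (p t) :=
  (continuous_cosM hp.fst).add (Continuous.fun_const_smul (continuous_sinM hp.snd) _)

/-- The forcing in the interaction picture. -/
def forcing (T t : ℝ) (x : L1 d) : L1 d × L1 d := (sinM t x, -(T • cosM t x))

lemma forcing_sub (T t : ℝ) (x y : L1 d) : forcing T t (x - y) = forcing T t x - forcing T t y := by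
  simp only [forcing, map_sub, smul_sub, Prod.mk_sub_mk, neg_sub_neg, neg_sub]

lemma norm_forcing_le {T t : ℝ} (hT : 0 < T) (ht : t ∈ Icc 0 T) (x : L1 d) :
    ‖forcing T t x‖ ≤ T * ‖x‖ := by
  refine max_le ?_ ?_
  · refine (norm_sinM_le _ _).trans ?_
    rw [abs_of_nonneg ht.1]
    exact mul_le_mul_of_nonneg_right ht.2 (norm_nonneg _)
  · change ‖-(T • cosM t x)‖ ≤ _
    rw [norm_neg, norm_smul, Real.norm_eq_abs, abs_of_pos hT]
    exact mul_le_mul_of_nonneg_left (norm_cosM_le _ _) hT.le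

lemma continuous_forcing (T : ℝ) {x : ℝ → L1 d} (hx : Continuous x) :
    Continuous fun t => forcing T t (x t) :=
  (continuous_sinM hx).prodMk (Continuous.fun_const_smul (continuous_cosM hx) T).neg

lemma norm_tri_self_sub_le {Y : ℝ} {x y : L1 d} (hx : ‖x‖ ≤ Y) (hy : ‖y‖ ≤ Y) :
    ‖tri x x x - tri y y y‖ ≤ 3 * Y ^ 2 * ‖x - y‖ := by
  have hY : 0 ≤ Y := (norm_nonneg _).trans hx
  have h1 : ‖tri (x - y) x x‖ ≤ ‖x - y‖ * Y * Y := (norm_tri_le _ _ _).trans (by gcongr)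
  have h2 : ‖tri y (x - y) x‖ ≤ Y * ‖x - y‖ * Y := (norm_tri_le _ _ _).trans (by gcongr)
  have h3 : ‖tri y y (x - y)‖ ≤ Y * Y * ‖x - y‖ := (norm_tri_le _ _ _).trans (by gcongr)
  rw [tri_sub_tri]
  have := norm_add₃_le (a := tri (x - y) x x) (b := tri y (x - y) x) (c := tri y y (x - y))
  linarith

/-- Local well-posedness of the cubic NLW in `ℱL¹`, with a quantitative bound. -/
theorem exists_solution {T B : ℝ} (hT : 0 < T) (hB : 0 ≤ B) (hTB : 8 * T * B ≤ 1)
    (v₀ v₁ : L1 d) (h₀ : ‖v₀‖ ≤ B) (h₁ : T * ‖v₁‖ ≤ B) :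
    ∃ u : ℝ → L1 d, Continuous u ∧ (∀ t ∈ Icc 0 T, ‖u t‖ ≤ 4 * B) ∧
      ∀ t ∈ Icc 0 T, ∀ n, u t n = (Real.cos (t * jap n) : ℂ) * v₀ n
        + ((Real.sin (t * jap n) / jap n : ℝ) : ℂ) * v₁ n
        - ∫ s in (0 : ℝ)..t,
          ((Real.sin ((t - s) * jap n) / jap n : ℝ) : ℂ) * tri (u s) (u s) (u s) n := by
  set f : ℝ → L1 d × L1 d → L1 d × L1 d := fun t p =>
    forcing T t (tri (fromProfile T t p) (fromProfile T t p) (fromProfile T t p)) with hf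
  set x₀ : L1 d × L1 d := (v₀, T • v₁) with hx₀
  have hx₀B : ‖x₀‖ ≤ B := max_le h₀ (by
    change ‖T • v₁‖ ≤ B
    rwa [norm_smul, Real.norm_eq_abs, abs_of_pos hT])
  have hball : ∀ p ∈ Metric.closedBall x₀ B, ‖p‖ ≤ 2 * B := fun p hp => by
    have := norm_le_of_mem_closedBall hp
    linarith
  have hprof : ∀ t ∈ Icc 0 T, ∀ p ∈ Metric.closedBall x₀ B, ‖fromProfile T t p‖ ≤ 4 * B :=
    fun t ht p hp => (norm_fromProfile_le hT ht p).trans (by linarith [hball p hp])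
  have hPL : IsPicardLindelof f (tmin := 0) (tmax := T) ⟨0, ⟨le_rfl, hT.le⟩⟩ x₀
      (⟨B, hB⟩ : NNReal) 0 (⟨T * (4 * B) ^ 3, by positivity⟩ : NNReal)
      (⟨T * (3 * (4 * B) ^ 2 * 2), by positivity⟩ : NNReal) := by
    refine ⟨fun t ht => LipschitzOnWith.of_dist_le_mul fun p hp q hq => ?_, fun p _ => ?_,
      fun t ht p hp => ?_, ?_⟩
    · rw [dist_eq_norm, dist_eq_norm, hf]
      simp only
      rw [← forcing_sub]
      refine (norm_forcing_le hT ht _).trans ?_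
      have h2 := norm_tri_self_sub_le (hprof t ht p hp) (hprof t ht q hq)
      rw [← fromProfile_sub] at h2
      have h3 := norm_fromProfile_le hT ht (p - q)
      change _ ≤ T * (3 * (4 * B) ^ 2 * 2) * _
      rw [mul_assoc T]
      refine mul_le_mul_of_nonneg_left (h2.trans ?_) hT.le
      rw [mul_assoc (3 * (4 * B) ^ 2)]
      exact mul_le_mul_of_nonneg_left h3 (by positivity)
    · exact (continuous_forcing T (continuous_tri_self.comp
        (continuous_fromProfile T continuous_const))).continuousOn
    · refine (norm_forcing_le hT ht _).trans ?_
      refine mul_le_mul_of_nonneg_left ((norm_tri_le _ _ _).trans ?_) hT.le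
      have h2 := hprof t ht p hp
      calc _ ≤ (4 * B) * (4 * B) * (4 * B) := by gcongr
        _ = _ := by ring
    · change T * (4 * B) ^ 3 * max (T - 0) (0 - 0) ≤ B - 0
      rw [sub_zero, sub_zero, sub_zero, max_eq_left hT.le]
      have h1 : (8 * T * B) ^ 2 ≤ 1 := pow_le_one₀ (by positivity) hTB
      nlinarith
  obtain ⟨α, hα⟩ := ODE.FunSpace.exists_isFixedPt_next hPL (x := x₀) (by simp)
  set w : ℝ → L1 d × L1 d := α.compProj with hw
  have hwc : Continuous w := α.continuous_compProj
  have hwball : ∀ t, w t ∈ Metric.closedBall x₀ B :=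
    fun t => α.compProj_mem_closedBall hPL.mul_max_le
  have hweq : ∀ t ∈ Icc 0 T, w t = x₀ + ∫ τ in (0 : ℝ)..t, f τ (w τ) := by
    intro t ht
    have h1 : w t = α.toFun ⟨t, ht⟩ := ODE.FunSpace.compProj_of_mem ht
    rw [h1]
    conv_lhs => rw [← hα]
    rfl
  set u : ℝ → L1 d := fun t => fromProfile T t (w t) with hu
  have huc : Continuous u := continuous_fromProfile T hwc
  refine ⟨u, huc, fun t ht => hprof t ht _ (hwball t), fun t ht n => ?_⟩
  set F : ℝ → L1 d := fun s => tri (u s) (u s) (u s) with hF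
  have hFc : Continuous F := continuous_tri_self.comp huc
  have hfc : Continuous fun τ => f τ (w τ) := continuous_forcing T hFc
  have hFn : Continuous fun s => F s n := (eval n).continuous.comp hFc
  have e1 : (w t).1 n = v₀ n + ∫ s in (0 : ℝ)..t,
      ((Real.sin (s * jap n) / jap n : ℝ) : ℂ) * F s n := by
    have := ((eval n).comp (ContinuousLinearMap.fst ℝ (L1 d) (L1 d))).intervalIntegral_comp_comm
      (hfc.intervalIntegrable (μ := volume) 0 t)
    have h2 := congrArg ((eval n).comp (ContinuousLinearMap.fst ℝ (L1 d) (L1 d))) (hweq t ht)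
    rw [map_add, ← this] at h2
    refine h2.trans ?_
    congr 1
    refine intervalIntegral.integral_congr fun s _ => ?_
    exact sinM_apply s (F s) n
  have e2 : (w t).2 n = T * v₁ n + ∫ s in (0 : ℝ)..t,
      -((T : ℂ) * ((Real.cos (s * jap n) : ℂ) * F s n)) := by
    have := ((eval n).comp (ContinuousLinearMap.snd ℝ (L1 d) (L1 d))).intervalIntegral_comp_comm
      (hfc.intervalIntegrable (μ := volume) 0 t)
    have h2 := congrArg ((eval n).comp (ContinuousLinearMap.snd ℝ (L1 d) (L1 d))) (hweq t ht)
    rw [map_add, ← this] at h2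
    refine h2.trans ?_
    congr 1
    refine intervalIntegral.integral_congr fun s _ => ?_
    change -((T : ℂ) * (cosM s (F s) n)) = _
    rw [cosM_apply]
  have e3 : u t n = (Real.cos (t * jap n) : ℂ) * (w t).1 n
      + (T : ℂ)⁻¹ * (((Real.sin (t * jap n) / jap n : ℝ) : ℂ) * (w t).2 n) := by
    change cosM t (w t).1 n + ((T⁻¹ : ℝ) : ℂ) * (sinM t (w t).2 n) = _
    rw [cosM_apply, sinM_apply, Complex.ofReal_inv]
  have hTc : (T : ℂ) ≠ 0 := by exact_mod_cast hT.ne'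
  have e4 : ∫ s in (0 : ℝ)..t, ((Real.sin ((t - s) * jap n) / jap n : ℝ) : ℂ) * F s n
      = ((Real.sin (t * jap n) / jap n : ℝ) : ℂ)
          * (∫ s in (0 : ℝ)..t, (Real.cos (s * jap n) : ℂ) * F s n)
        - (Real.cos (t * jap n) : ℂ)
          * ∫ s in (0 : ℝ)..t, ((Real.sin (s * jap n) / jap n : ℝ) : ℂ) * F s n := by
    rw [← intervalIntegral.integral_const_mul, ← intervalIntegral.integral_const_mul,
      ← intervalIntegral.integral_sub]
    · refine intervalIntegral.integral_congr fun s _ => ?_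
      simp only [sub_mul, Real.sin_sub]
      push_cast
      ring
    · exact (by fun_prop : Continuous _).intervalIntegrable _ _
    · exact (by fun_prop : Continuous _).intervalIntegrable _ _
  rw [e3, e1, e2, e4, intervalIntegral.integral_neg, intervalIntegral.integral_const_mul]
  field_simp
  ring

end L1

namespace L1

variable {d : ℕ}

/-- The linear evolution of the data `(x, y)`. -/
def lin (t : ℝ) (x y : L1 d) : L1 d := cosM t x + sinM t y

lemma norm_lin_le {t K : ℝ} (ht : |t| ≤ 1) {x y : L1 d} (h : ‖x‖ + ‖y‖ ≤ K) :
    ‖lin t x y‖ ≤ K := by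
  have h1 := norm_cosM_le t x
  have h2 : ‖sinM t y‖ ≤ ‖y‖ :=
    (norm_sinM_le t y).trans (mul_le_of_le_one_left (norm_nonneg _) ht)
  exact (norm_add_le _ _).trans (by linarith)

lemma norm_tri_apply_sub_le {K Y Z : ℝ} {U z : L1 d} (hU : ‖U‖ ≤ K) (hKY : K ≤ Y)
    (hg : ‖U + z‖ ≤ Y) (hz : ‖z‖ ≤ Y) (hZ : ∀ n, ‖z n‖ ≤ Z) (n : Freq d) :
    ‖tri (U + z) (U + z) (U + z) n - tri z z z n‖ ≤ K ^ 3 + 4 * K * Y * Z := by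
  have hK : 0 ≤ K := (norm_nonneg _).trans hU
  have hY : 0 ≤ Y := hK.trans hKY
  have hZ0 : 0 ≤ Z := (norm_nonneg _).trans (hZ 0)
  set g := U + z with hgdef
  have hdec : tri g g g - tri z z z
      = (tri U U U + tri U z U + tri U g z) + tri z U g + tri z z U := by
    rw [tri_sub_tri, hgdef, add_sub_cancel_right]
    congr 2
    simp only [tri, map_add, add_apply]
  have hdecn := congrArg (eval n) hdec
  simp only [map_add, map_sub, eval_apply] at hdecn
  rw [hdecn]
  have h1 : ‖tri U U U n‖ ≤ K * K * K :=
    (norm_apply_le _ _).trans ((norm_tri_le _ _ _).trans (by gcongr))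
  have h2 : ‖tri U z U n‖ ≤ K * Z * Y :=
    (norm_tri_apply_le₂ U z U hZ n).trans (by gcongr; exact hU.trans hKY)
  have h3 : ‖tri U g z n‖ ≤ K * Y * Z := (norm_tri_apply_le₃ U g z hZ n).trans (by gcongr)
  have h4 : ‖tri z U g n‖ ≤ Z * K * Y := (norm_tri_apply_le₁ z U g hZ n).trans (by gcongr)
  have h5 : ‖tri z z U n‖ ≤ Z * Y * K := (norm_tri_apply_le₁ z z U hZ n).trans (by gcongr)
  have e1 := norm_add_le (tri U U U n + tri U z U n + tri U g z n + tri z U g n) (tri z z U n)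
  have e2 := norm_add_le (tri U U U n + tri U z U n + tri U g z n) (tri z U g n)
  have e3 := norm_add₃_le (a := tri U U U n) (b := tri U z U n) (c := tri U g z n)
  linarith

lemma norm_tri_self_apply_le {Y Z : ℝ} {z : L1 d} (hz : ‖z‖ ≤ Y) (hZ : ∀ n, ‖z n‖ ≤ Z)
    (n : Freq d) : ‖tri z z z n‖ ≤ Y ^ 2 * Z := by
  have hZ0 : 0 ≤ Z := (norm_nonneg _).trans (hZ 0)
  have hY : 0 ≤ Y := (norm_nonneg _).trans hz
  calc _ ≤ ‖z‖ * ‖z‖ * Z := norm_tri_apply_le₃ z z z hZ n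
    _ ≤ Y * Y * Z := by gcongr
    _ = _ := by ring

lemma norm_tri_self_apply_sub_le {Y W : ℝ} {x y : L1 d} (hx : ‖x‖ ≤ Y) (hy : ‖y‖ ≤ Y)
    (hW : ∀ n, ‖(x - y) n‖ ≤ W) (n : Freq d) :
    ‖tri x x x n - tri y y y n‖ ≤ 3 * Y ^ 2 * W := by
  have hW0 : 0 ≤ W := (norm_nonneg _).trans (hW 0)
  have hY : 0 ≤ Y := (norm_nonneg _).trans hx
  have hdecn := congrArg (eval n) (tri_sub_tri x y)
  simp only [map_add, map_sub (eval n), eval_apply] at hdecn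
  rw [hdecn]
  have h1 : ‖tri (x - y) x x n‖ ≤ W * Y * Y :=
    (norm_tri_apply_le₁ _ _ _ hW n).trans (by gcongr)
  have h2 : ‖tri y (x - y) x n‖ ≤ Y * W * Y :=
    (norm_tri_apply_le₂ _ _ _ hW n).trans (by gcongr)
  have h3 : ‖tri y y (x - y) n‖ ≤ Y * Y * W :=
    (norm_tri_apply_le₃ _ _ _ hW n).trans (by gcongr)
  have := norm_add₃_le (a := tri (x - y) x x n) (b := tri y (x - y) x n) (c := tri y y (x - y) n)
  linarith

lemma norm_duhamel_le {T G t : ℝ} (ht : t ∈ Icc 0 T) {n : Freq d} {F : ℝ → ℂ}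
    (hF : ∀ s ∈ Icc 0 T, ‖F s‖ ≤ G) :
    ‖∫ s in (0 : ℝ)..t, ((Real.sin ((t - s) * jap n) / jap n : ℝ) : ℂ) * F s‖ ≤ T ^ 2 * G := by
  have hT : 0 ≤ T := ht.1.trans ht.2
  have hG : 0 ≤ G := (norm_nonneg _).trans (hF t ht)
  have := intervalIntegral.norm_integral_le_of_norm_le_const (a := 0) (b := t) (C := T * G)
    (f := fun s => ((Real.sin ((t - s) * jap n) / jap n : ℝ) : ℂ) * F s) (fun s hs => by
      rw [uIoc_of_le ht.1] at hs
      rw [norm_mul, Complex.norm_real, Real.norm_eq_abs]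
      refine mul_le_mul ?_ (hF s ⟨hs.1.le, hs.2.trans ht.2⟩) (norm_nonneg _) hT
      refine (abs_sin_div_jap_le _ n).trans ?_
      rw [abs_of_nonneg (by linarith [hs.2])]
      linarith [hs.1, ht.2])
  refine this.trans ?_
  rw [sub_zero, abs_of_nonneg ht.1]
  nlinarith [mul_le_mul_of_nonneg_left ht.2 (mul_nonneg hT hG)]

/-- A self-improving bound `Z ↦ r + Z / 2` forces the bound `2 r`. -/
lemma le_two_mul_of_self_improving {ι : Type*} {a : ι → ℝ} {r Z₀ : ℝ} (h₀ : ∀ i, a i ≤ Z₀)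
    (h : ∀ Z, (∀ i, a i ≤ Z) → ∀ i, a i ≤ r + Z / 2) (i : ι) : a i ≤ 2 * r := by
  have : Nonempty ι := ⟨i⟩
  have hb : BddAbove (range a) := ⟨Z₀, by rintro _ ⟨j, rfl⟩; exact h₀ j⟩
  have h1 : ⨆ j, a j ≤ r + (⨆ j, a j) / 2 := ciSup_le (h _ fun j => le_ciSup hb j)
  linarith [le_ciSup hb i]

/-- Pointwise comparison of the nonlinearity with its first Picard iterate. -/
lemma norm_tri_sub_tri_cosM_le {T K Y R : ℝ} (hT : 0 < T) (hT1 : T ≤ 1) (hKY : K ≤ Y)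
    (hTY : 40 * T ^ 2 * Y ^ 2 ≤ 1) (hTK : T ^ 2 * K ^ 3 ≤ R)
    {U₀ U₁ φ : L1 d} (hU : ‖U₀‖ + ‖U₁‖ ≤ K) (hφ : ‖φ‖ ≤ Y) (hφR : ∀ n, ‖φ n‖ ≤ R)
    {u : ℝ → L1 d} (huY : ∀ t ∈ Icc 0 T, ‖u t‖ ≤ Y)
    (hu : ∀ t ∈ Icc 0 T, ∀ n, u t n = (Real.cos (t * jap n) : ℂ) * (U₀ + φ) n
        + ((Real.sin (t * jap n) / jap n : ℝ) : ℂ) * U₁ n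
        - ∫ s in (0 : ℝ)..t,
          ((Real.sin ((t - s) * jap n) / jap n : ℝ) : ℂ) * tri (u s) (u s) (u s) n)
    {t : ℝ} (ht : t ∈ Icc 0 T) (n : Freq d) :
    ‖tri (u t) (u t) (u t) n - tri (cosM t φ) (cosM t φ) (cosM t φ) n‖
      ≤ K ^ 3 + 32 * K * Y * R
        + 12 * Y ^ 2 * (T ^ 2 * (K ^ 3 + 32 * K * Y * R + 16 * Y ^ 2 * R)) := by
  have hK : 0 ≤ K := (add_nonneg (norm_nonneg _) (norm_nonneg _)).trans hU
  have hY : 0 ≤ Y := hK.trans hKY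
  have hR : 0 ≤ R := (norm_nonneg _).trans (hφR 0)
  set U : ℝ → L1 d := fun t => lin t U₀ U₁ with hUdef
  set z : ℝ → L1 d := fun t => u t - U t with hzdef
  have hUK : ∀ s ∈ Icc 0 T, ‖U s‖ ≤ K := fun s hs =>
    norm_lin_le (by rw [abs_of_nonneg hs.1]; exact hs.2.trans hT1) hU
  have hzY : ∀ s ∈ Icc 0 T, ‖z s‖ ≤ 2 * Y := fun s hs =>
    (norm_sub_le _ _).trans (by linarith [huY s hs, hUK s hs])
  have hUz : ∀ s, U s + z s = u s := fun s => by simp [hzdef]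
  have hw : ∀ s ∈ Icc 0 T, ∀ m, (z s - cosM s φ) m = -∫ τ in (0 : ℝ)..s,
      ((Real.sin ((s - τ) * jap m) / jap m : ℝ) : ℂ) * tri (u τ) (u τ) (u τ) m := by
    intro s hs m
    change u s m - (cosM s U₀ m + sinM s U₁ m) - cosM s φ m = _
    rw [hu s hs m, cosM_apply, cosM_apply, sinM_apply, lp.coeFn_add, Pi.add_apply]
    ring
  have hcube : ∀ Z, (∀ p : Icc (0 : ℝ) T × Freq d, ‖z p.1 p.2‖ ≤ Z) → ∀ s ∈ Icc 0 T, ∀ m,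
      ‖tri (u s) (u s) (u s) m - tri (z s) (z s) (z s) m‖ ≤ K ^ 3 + 4 * K * (2 * Y) * Z := by
    intro Z hZ s hs m
    have := norm_tri_apply_sub_le (hUK s hs) (by linarith : K ≤ 2 * Y)
      (by rw [hUz]; linarith [huY s hs]) (hzY s hs) (fun k => hZ (⟨s, hs⟩, k)) m
    rwa [hUz] at this
  have hwZ : ∀ Z, (∀ p : Icc (0 : ℝ) T × Freq d, ‖z p.1 p.2‖ ≤ Z) → ∀ s ∈ Icc 0 T, ∀ m,
      ‖(z s - cosM s φ) m‖ ≤ T ^ 2 * (K ^ 3 + 4 * K * (2 * Y) * Z + (2 * Y) ^ 2 * Z) := by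
    intro Z hZ s hs m
    rw [hw s hs m, norm_neg]
    refine norm_duhamel_le hs fun τ hτ => ?_
    have h1 := hcube Z hZ τ hτ m
    have h2 := norm_tri_self_apply_le (hzY τ hτ) (fun k => hZ (⟨τ, hτ⟩, k)) m
    have h3 := norm_add_le (tri (u τ) (u τ) (u τ) m - tri (z τ) (z τ) (z τ) m)
      (tri (z τ) (z τ) (z τ) m)
    rw [sub_add_cancel] at h3
    linarith
  have hφs : ∀ s m, ‖cosM s φ m‖ ≤ R := fun s m => by
    rw [cosM_apply, norm_mul, Complex.norm_real, Real.norm_eq_abs]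
    exact (mul_le_of_le_one_left (norm_nonneg _) (abs_cos_jap_le s m)).trans (hφR m)
  have hz4 : ∀ p : Icc (0 : ℝ) T × Freq d, ‖z p.1 p.2‖ ≤ 2 * (2 * R) := by
    refine le_two_mul_of_self_improving (Z₀ := 2 * Y)
      (fun p => (norm_apply_le _ _).trans (hzY p.1 p.1.2)) fun Z hZ p => ?_
    have hZ0 : 0 ≤ Z := (norm_nonneg _).trans (hZ p)
    have h1 := hwZ Z hZ p.1 p.1.2 p.2
    have h2 := norm_add_le ((z p.1 - cosM p.1 φ) p.2) (cosM p.1 φ p.2)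
    rw [lp.coeFn_sub, Pi.sub_apply, sub_add_cancel] at h2
    rw [lp.coeFn_sub, Pi.sub_apply] at h1
    have h3 := hφs p.1 p.2
    have h4 : T ^ 2 * (K * Y * Z) ≤ T ^ 2 * (Y * Y * Z) := by gcongr
    have h5 := mul_le_mul_of_nonneg_right hTY hZ0
    have h6 : 0 ≤ T ^ 2 * (Y * Y * Z) := by positivity
    nlinarith
  have h1 := hcube _ hz4 t ht n
  have h2 := norm_tri_self_apply_sub_le (hzY t ht)
    ((norm_cosM_le t φ).trans (by linarith : ‖φ‖ ≤ 2 * Y)) (hwZ _ hz4 t ht) n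
  have h3 := norm_sub_le_norm_sub_add_norm_sub (tri (u t) (u t) (u t) n)
    (tri (z t) (z t) (z t) n) (tri (cosM t φ) (cosM t φ) (cosM t φ) n)
  refine h3.trans ((add_le_add h1 h2).trans (le_of_eq ?_))
  ring

/-- Lower bound for a Duhamel term whose forcing has positive real part. -/
lemma le_norm_duhamel {T κ : ℝ} (hT : 0 ≤ T) {n : Freq d} (hTn : T * jap n ≤ 1) {F : ℝ → ℂ}
    (hFc : Continuous F) (hκ : 0 ≤ κ) (hF : ∀ s ∈ Icc 0 T, κ ≤ (F s).re) :
    T ^ 2 * κ / 4 ≤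
      ‖∫ s in (0 : ℝ)..T, ((Real.sin ((T - s) * jap n) / jap n : ℝ) : ℂ) * F s‖ := by
  set G : ℝ → ℂ := fun s => ((Real.sin ((T - s) * jap n) / jap n : ℝ) : ℂ) * F s with hG
  have hGc : Continuous G := by fun_prop
  refine le_trans ?_ (Complex.re_le_norm _)
  have hre := Complex.reCLM.intervalIntegral_comp_comm
    (hGc.intervalIntegrable (μ := volume) 0 T)
  simp only [Complex.reCLM_apply] at hre
  rw [← hre]
  have hle : ∫ s in (0 : ℝ)..T, (T - s) / 2 * κ ≤ ∫ s in (0 : ℝ)..T, (G s).re := by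
    refine intervalIntegral.integral_mono_on hT
      ((by fun_prop : Continuous _).intervalIntegrable _ _)
      ((Complex.continuous_re.comp hGc).intervalIntegrable _ _) fun s hs => ?_
    rw [hG]
    simp only [Complex.re_ofReal_mul]
    have hx0 : 0 ≤ (T - s) * jap n := mul_nonneg (by linarith [hs.2]) (jap_pos n).le
    have hx1 : (T - s) * jap n ≤ 1 :=
      (mul_le_mul_of_nonneg_right (by linarith [hs.1]) (jap_pos n).le).trans hTn
    have hsin : (T - s) * jap n / 2 ≤ Real.sin ((T - s) * jap n) := by
      refine le_trans ?_ (Real.mul_le_sin hx0 (by linarith [Real.pi_gt_three]))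
      have : 1 / 2 ≤ 2 / Real.pi := by
        rw [div_le_div_iff₀ two_pos Real.pi_pos]; linarith [Real.pi_le_four]
      nlinarith
    refine mul_le_mul ?_ (hF s hs) hκ (div_nonneg (by linarith) (jap_pos n).le)
    rw [le_div_iff₀ (jap_pos n)]
    linarith
  refine le_trans (le_of_eq ?_) hle
  rw [intervalIntegral.integral_mul_const, intervalIntegral.integral_div,
    intervalIntegral.integral_sub (by simp) (by simp)]
  simp
  ring

end L1

section Boxes

variable {d : ℕ}

/-- The cube in `ℤ^d` with centre `(c, …, c)` and radius `a`. -/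
def box (d : ℕ) (c a : ℤ) : Finset (Freq d) := Finset.Icc (fun _ => c - a) (fun _ => c + a)

lemma mem_box {c a : ℤ} {n : Freq d} : n ∈ box d c a ↔ ∀ i, c - a ≤ n i ∧ n i ≤ c + a := by
  simp [box, Finset.mem_Icc, Pi.le_def, forall_and]

lemma card_box (c : ℤ) (a : ℕ) : (box d c a).card = (2 * a + 1) ^ d := by
  rw [box, Pi.card_Icc]
  simp only [Int.card_Icc, Finset.prod_const, Finset.card_univ, Fintype.card_fin]
  congr 1
  omega

lemma neg_mem_box {c a : ℤ} {n : Freq d} : -n ∈ box d c a ↔ n ∈ box d (-c) a := by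
  simp only [mem_box, Pi.neg_apply]
  exact forall_congr' fun i => ⟨fun h => ⟨by linarith [h.2], by linarith [h.1]⟩,
    fun h => ⟨by linarith [h.2], by linarith [h.1]⟩⟩

lemma abs_le_jap (n : Freq d) (i : Fin d) : |(n i : ℝ)| ≤ jap n := by
  rw [jap]
  refine Real.abs_le_sqrt ?_
  linarith [Finset.single_le_sum (f := fun i => ((n i : ℝ)) ^ 2) (fun i _ => sq_nonneg _)
    (Finset.mem_univ i)]

lemma jap_le {X : ℝ} (hX : 1 ≤ X) {n : Freq d} (h : ∀ i, |(n i : ℝ)| ≤ X) :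
    jap n ≤ (d + 1) * X := by
  rw [jap]
  refine Real.sqrt_le_iff.2 ⟨by positivity, ?_⟩
  have h1 : ∑ i, ((n i : ℝ)) ^ 2 ≤ ∑ _i : Fin d, X ^ 2 :=
    Finset.sum_le_sum fun i _ => by
      rw [← sq_abs]; exact pow_le_pow_left₀ (abs_nonneg _) (h i) 2
  rw [Finset.sum_const, Finset.card_univ, Fintype.card_fin, nsmul_eq_mul] at h1
  have hd : (0 : ℝ) ≤ d := Nat.cast_nonneg d
  have h2 : 1 ≤ X ^ 2 := one_le_pow₀ hX
  have h3 : 0 ≤ (d : ℝ) * X ^ 2 := by positivity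
  have h4 : 0 ≤ (d : ℝ) ^ 2 * X ^ 2 := by positivity
  nlinarith

/-- Four cubes of radius `2A` centred at `±N` and `±2N`. -/
def fourBoxes (d N A : ℕ) : Finset (Freq d) :=
  (box d N (2 * A) ∪ box d (-N) (2 * A)) ∪ (box d (2 * N) (2 * A) ∪ box d (-(2 * N)) (2 * A))

lemma mem_fourBoxes {N A : ℕ} {n : Freq d} : n ∈ fourBoxes d N A ↔
    (n ∈ box d N (2 * A) ∨ n ∈ box d (-N) (2 * A)) ∨
      (n ∈ box d (2 * N) (2 * A) ∨ n ∈ box d (-(2 * N)) (2 * A)) := by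
  simp only [fourBoxes, Finset.mem_union]

lemma neg_mem_fourBoxes {N A : ℕ} {n : Freq d} :
    -n ∈ fourBoxes d N A ↔ n ∈ fourBoxes d N A := by
  simp only [mem_fourBoxes, neg_mem_box, neg_neg]
  tauto

lemma card_fourBoxes_le {N A : ℕ} (hA : 1 ≤ A) :
    ((fourBoxes d N A).card : ℝ) ≤ 4 * 5 ^ d * (A : ℝ) ^ d := by
  have h : ∀ c : ℤ, (box d c (2 * (A : ℤ))).card ≤ (5 * A) ^ d := fun c => by
    have := card_box (d := d) c (2 * A)
    push_cast at this
    rw [this]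
    exact Nat.pow_le_pow_left (by omega) d
  have h1 : (fourBoxes d N A).card ≤ 4 * (5 * A) ^ d := by
    have e1 := Finset.card_union_le (box d N (2 * A) ∪ box d (-N) (2 * A))
      (box d (2 * N) (2 * A) ∪ box d (-(2 * N)) (2 * A))
    have e2 := Finset.card_union_le (box d N (2 * A)) (box d (-N) (2 * A))
    have e3 := Finset.card_union_le (box d (2 * N) (2 * A)) (box d (-(2 * N)) (2 * A))
    have := h N; have := h (-N); have := h (2 * N); have := h (-(2 * N))
    unfold fourBoxes
    omega
  calc ((fourBoxes d N A).card : ℝ) ≤ ((4 * (5 * A) ^ d : ℕ) : ℝ) := by exact_mod_cast h1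
    _ = _ := by push_cast; ring

lemma abs_bounds_of_mem_fourBoxes {N A : ℕ} (hN : 6 * A ≤ N) {n : Freq d}
    (hn : n ∈ fourBoxes d N A) (i : Fin d) : (N : ℤ) ≤ 2 * |n i| ∧ |n i| ≤ 3 * N := by
  rcases abs_cases (n i) with ⟨h, h'⟩ | ⟨h, h'⟩ <;> rw [h] <;>
  rcases mem_fourBoxes.1 hn with (h0 | h0) | (h0 | h0) <;>
  have := mem_box.1 h0 i <;> omega

lemma jap_le_of_mem_fourBoxes {N A : ℕ} (hA : 1 ≤ A) (hN : 6 * A ≤ N) {n : Freq d}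
    (hn : n ∈ fourBoxes d N A) : jap n ≤ (d + 1) * (3 * N) := by
  have hN1 : (1 : ℝ) ≤ N := by exact_mod_cast (by omega : 1 ≤ N)
  exact jap_le (by linarith) fun i => by
    exact_mod_cast (abs_bounds_of_mem_fourBoxes hN hn i).2

lemma le_jap_of_mem_fourBoxes (hd : 1 ≤ d) {N A : ℕ} (hN : 6 * A ≤ N) {n : Freq d}
    (hn : n ∈ fourBoxes d N A) : (N : ℝ) / 2 ≤ jap n := by
  have h1 := abs_le_jap n ⟨0, hd⟩
  have h2 : (N : ℝ) ≤ 2 * |(n ⟨0, hd⟩ : ℝ)| := by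
    exact_mod_cast (abs_bounds_of_mem_fourBoxes hN hn ⟨0, hd⟩).1
  linarith

lemma notMem_fourBoxes (hd : 1 ≤ d) {N A : ℕ} (hA : 1 ≤ A) (hN : 6 * A ≤ N) {n : Freq d}
    (hn : n ∈ box d 0 A) : n ∉ fourBoxes d N A := fun h => by
  have h1 := (abs_bounds_of_mem_fourBoxes hN h ⟨0, hd⟩).1
  have h2 := mem_box.1 hn ⟨0, hd⟩
  have h3 : |n ⟨0, hd⟩| ≤ A := abs_le.2 ⟨by linarith [h2.1], by linarith [h2.2]⟩
  omega

end Boxes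

section LowerBound

variable {d : ℕ}

lemma dconv_ofReal (a b : Freq d → ℝ) :
    dconv (fun n => (a n : ℂ)) (fun n => (b n : ℂ))
      = fun n => ((∑' m, a m * b (n - m) : ℝ) : ℂ) := by
  ext n
  simp only [dconv, Complex.ofReal_tsum, Complex.ofReal_mul]

lemma card_mul_le_tsum_conv {a b : Freq d → ℝ} (ha : ∀ n, 0 ≤ a n) (hb : ∀ n, 0 ≤ b n)
    (hsa : Summable a) (hsb : Summable b) {n : Freq d} {c : ℝ} (S : Finset (Freq d))
    (h : ∀ m ∈ S, c ≤ a m * b (n - m)) : S.card * c ≤ ∑' m, a m * b (n - m) := by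
  have hs : Summable fun m => a m * b (n - m) := by
    have := summable_conv_fiber (f := fun n => (a n : ℂ)) (g := fun n => (b n : ℂ))
      (by simpa [abs_of_nonneg (ha _)] using hsa) (by simpa [abs_of_nonneg (hb _)] using hsb) n
    simpa [abs_of_nonneg (ha _), abs_of_nonneg (hb _)] using this
  calc S.card * c = ∑ _m ∈ S, c := by rw [Finset.sum_const, nsmul_eq_mul]
    _ ≤ ∑ m ∈ S, a m * b (n - m) := Finset.sum_le_sum h
    _ ≤ _ := hs.sum_le_tsum S fun m _ => mul_nonneg (ha _) (hb _)

/-- High-to-low interaction: the cube of a profile that is at least `ρ` on the four boxes is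
bounded below on the low-frequency box. -/
lemma le_re_dcube {N A : ℕ} {ψ : Freq d → ℝ} {ρ : ℝ} (hρ : 0 ≤ ρ) (hψ : ∀ n, 0 ≤ ψ n)
    (hs : Summable ψ) (hψρ : ∀ n ∈ fourBoxes d N A, ρ ≤ ψ n) {n : Freq d} (hn : n ∈ box d 0 A) :
    ρ ^ 3 * ((A : ℝ) ^ d) ^ 2 ≤ (dcube (fun n => (ψ n : ℂ)) n).re := by
  set Q := box d 0 A with hQ
  set θ : Freq d → ℝ := fun n => ∑' m, ψ m * ψ (n - m) with hθ
  have hθ0 : ∀ n, 0 ≤ θ n := fun n => tsum_nonneg fun m => mul_nonneg (hψ _) (hψ _)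
  have hsn : Summable fun n => ‖(ψ n : ℂ)‖ := by simpa [abs_of_nonneg (hψ _)] using hs
  have hθs : Summable θ := by
    have := summable_norm_dconv hsn hsn
    rw [dconv_ofReal] at this
    simp only [Complex.norm_real, Real.norm_eq_abs] at this
    exact this.congr fun n => abs_of_nonneg (hθ0 n)
  have hshift : ∀ c : ℤ, (Q.image fun x => x + fun _ => c).card = Q.card := fun c =>
    Finset.card_image_of_injective _ (add_left_injective _)
  have hθQ : ∀ μ ∈ Q, Q.card * (ρ * ρ) ≤ θ (μ + fun _ => 2 * (N : ℤ)) := by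
    intro μ hμ
    rw [← hshift N]
    refine card_mul_le_tsum_conv hψ hψ hs hs _ fun m hm => ?_
    obtain ⟨x, hx, rfl⟩ := Finset.mem_image.1 hm
    refine mul_le_mul (hψρ _ ?_) (hψρ _ ?_) hρ (hψ _) <;>
    · refine mem_fourBoxes.2 (.inl (.inl (mem_box.2 fun i => ?_)))
      have h1 := mem_box.1 hx i
      have h2 := mem_box.1 hμ i
      simp only [Pi.add_apply, Pi.sub_apply]
      omega
  have hcube : dcube (fun n => (ψ n : ℂ)) n = ((∑' m, θ m * ψ (n - m) : ℝ) : ℂ) := by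
    rw [dcube, dconv_ofReal, dconv_ofReal]
  rw [hcube, Complex.ofReal_re]
  have hQc : (A : ℝ) ^ d ≤ Q.card := by
    rw [hQ, card_box]
    push_cast
    exact pow_le_pow_left₀ (Nat.cast_nonneg A) (by linarith [(Nat.cast_nonneg A : (0 : ℝ) ≤ A)]) d
  calc ρ ^ 3 * ((A : ℝ) ^ d) ^ 2 ≤ ρ ^ 3 * (Q.card : ℝ) ^ 2 := by gcongr
    _ = (Q.image fun x => x + fun _ => 2 * (N : ℤ)).card * (Q.card * (ρ * ρ) * ρ) := by
        rw [hshift]; ring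
    _ ≤ _ := by
        refine card_mul_le_tsum_conv hθ0 hψ hθs hs _ fun m hm => ?_
        obtain ⟨x, hx, rfl⟩ := Finset.mem_image.1 hm
        refine mul_le_mul (hθQ x hx) (hψρ _ ?_) hρ (hθ0 _)
        refine mem_fourBoxes.2 (.inr (.inr (mem_box.2 fun i => ?_)))
        have h1 := mem_box.1 hx i
        have h2 := mem_box.1 hn i
        simp only [Pi.add_apply, Pi.sub_apply]
        omega

end LowerBound

section Truncation

variable {d : ℕ}

namespace L1

/-- The truncation of a sequence to a finite set of frequencies. -/
def truncate (S : Finset (Freq d)) (f : Freq d → ℂ) : L1 d :=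
  ofSummable (fun n => if n ∈ S then f n else 0) <|
    summable_of_ne_finset_zero (s := S) fun n hn => by simp [hn]

lemma truncate_apply (S : Finset (Freq d)) (f : Freq d → ℂ) (n : Freq d) :
    truncate S f n = if n ∈ S then f n else 0 := by simp [truncate]

lemma norm_truncate_const_le (S : Finset (Freq d)) {R : ℝ} (hR : 0 ≤ R) :
    ‖truncate S fun _ => (R : ℂ)‖ ≤ S.card * R := by
  rw [norm_eq_tsum, tsum_eq_sum (s := S) fun n hn => by simp [truncate_apply, hn]]
  refine (Finset.sum_le_card_nsmul S _ R fun n hn => ?_).trans_eq (nsmul_eq_mul _ _)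
  simp [truncate_apply, hn, abs_of_nonneg hR]

lemma truncate_neg {S : Finset (Freq d)} (hS : ∀ n, -n ∈ S ↔ n ∈ S) {f : Freq d → ℂ}
    (hf : ∀ n, f (-n) = starRingEnd ℂ (f n)) (n : Freq d) :
    truncate S f (-n) = starRingEnd ℂ (truncate S f n) := by
  by_cases hn : n ∈ S <;> simp [truncate_apply, hS, hn, hf]

end L1

end Truncation

section Core

variable {d : ℕ}

namespace L1

/-- The parameter inequalities under which the first Picard iterate dominates. -/
lemma parameter_bounds {K R T M C Y : ℝ} (hK : 1 ≤ K) (hR : 0 < R) (hT : 0 < T) (hC1 : 1 ≤ C)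
    (hTM : 5100 * C ^ 2 * (T * M) ≤ 1) (hMK : 32768 * K * C ≤ M) (hRM : 128 * K ^ 3 ≤ R * M ^ 2)
    (hY : Y = 8 * (C * M)) :
    8 * T * (2 * (C * M)) ≤ 1 ∧ T * K ≤ 2 * (C * M) ∧ K ≤ C * M ∧ 40 * T ^ 2 * Y ^ 2 ≤ 1 ∧
      T ^ 2 * K ^ 3 ≤ R ∧ K ^ 3 + 32 * K * Y * R
      + 12 * Y ^ 2 * (T ^ 2 * (K ^ 3 + 32 * K * Y * R + 16 * Y ^ 2 * R)) ≤ R * M ^ 2 / 16 := by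
  have hC0 : 0 < C := by linarith
  have hK0 : 0 < K := by linarith
  have hM0 : 0 < M := by nlinarith
  have hY0 : 0 < Y := by rw [hY]; positivity
  have hTM0 : 0 < T * M := mul_pos hT hM0
  have hCM : K ≤ C * M := by nlinarith
  have hCTM : 5100 * (C * (T * M)) ≤ 1 := by nlinarith
  have hCTM0 : 0 < C * (T * M) := by positivity
  have hTY : T * Y = 8 * (C * (T * M)) := by rw [hY]; ring
  have hTY2 : T ^ 2 * Y ^ 2 = 64 * (C * (T * M)) ^ 2 := by rw [← mul_pow, hTY]; ring
  have hsq : (C * (T * M)) ^ 2 ≤ (1 / 5100) ^ 2 := by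
    gcongr; linarith
  have hRMpos : 0 < R * M ^ 2 := by positivity
  have hK3 : 0 < K ^ 3 := by positivity
  have hTM1 : T * M ≤ 1 := by nlinarith
  have hTKR : T ^ 2 * K ^ 3 ≤ R := by
    have : (T * M) ^ 2 ≤ 1 := pow_le_one₀ hTM0.le hTM1
    nlinarith [mul_le_mul_of_nonneg_left hRM (sq_nonneg T)]
  have hmid : 32 * K * Y * R ≤ R * M ^ 2 / 128 := by
    have := mul_le_mul_of_nonneg_right hMK (by positivity : 0 ≤ R * M)
    rw [hY]; linarith
  have hlast : 12 * Y ^ 2 * (T ^ 2 * (16 * Y ^ 2 * R)) ≤ R * M ^ 2 / 32 := by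
    have h1 : 12 * Y ^ 2 * (T ^ 2 * (16 * Y ^ 2 * R))
        = 786432 * (C ^ 2 * (T * M)) ^ 2 * (R * M ^ 2) := by rw [hY]; ring
    have h2 : (C ^ 2 * (T * M)) ^ 2 ≤ (1 / 5100) ^ 2 := by
      gcongr; linarith
    rw [h1]
    nlinarith
  have herr : K ^ 3 + 32 * K * Y * R
      + 12 * Y ^ 2 * (T ^ 2 * (K ^ 3 + 32 * K * Y * R + 16 * Y ^ 2 * R)) ≤ R * M ^ 2 / 16 := by
    have h1 : 12 * (T ^ 2 * Y ^ 2) ≤ 1 := by rw [hTY2]; linarith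
    have h2 : 0 ≤ K ^ 3 + 32 * K * Y * R := by positivity
    have h3 := mul_le_mul_of_nonneg_right h1 h2
    linarith
  refine ⟨by linarith, ?_, hCM, by rw [mul_assoc, hTY2]; linarith, hTKR, herr⟩
  nlinarith [mul_le_mul_of_nonneg_left hMK hT.le]

lemma le_re_tri_cosM {N A : ℕ} (hA : 1 ≤ A) (hN : 6 * A ≤ N) {R t : ℝ} (hR : 0 ≤ R)
    (ht : 0 ≤ t) (htN : 3 * (d + 1) * (t * N) ≤ 1) {φ : L1 d}
    (hφ : φ = truncate (fourBoxes d N A) fun _ => (R : ℂ)) {n : Freq d} (hn : n ∈ box d 0 A) :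
    R * (R * (A : ℝ) ^ d) ^ 2 / 8 ≤ (tri (cosM t φ) (cosM t φ) (cosM t φ) n).re := by
  set ψ : Freq d → ℝ := fun n => if n ∈ fourBoxes d N A then Real.cos (t * jap n) * R else 0
    with hψ
  have hcos : ∀ n ∈ fourBoxes d N A, 1 / 2 ≤ Real.cos (t * jap n) := fun n hn => by
    have h1 := jap_le_of_mem_fourBoxes hA hN hn
    have h2 : t * jap n ≤ 1 := by nlinarith
    have h3 : 0 ≤ t * jap n := mul_nonneg ht (jap_pos n).le
    nlinarith [Real.one_sub_sq_div_two_le_cos (x := t * jap n)]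
  have hψρ : ∀ n ∈ fourBoxes d N A, R / 2 ≤ ψ n := fun n hn => by
    simp only [hψ, if_pos hn]
    nlinarith [hcos n hn]
  have hψ0 : ∀ n, 0 ≤ ψ n := fun n => by
    by_cases hn : n ∈ fourBoxes d N A
    · exact (by positivity : 0 ≤ R / 2).trans (hψρ n hn)
    · simp [hψ, hn]
  have hc : ⇑(cosM t φ) = fun n => (ψ n : ℂ) := by
    ext n
    rw [cosM_apply, hφ, truncate_apply]
    by_cases hn : n ∈ fourBoxes d N A <;> simp [hψ, hn]
  rw [coe_tri_self, hc]
  refine le_trans (le_of_eq ?_) (le_re_dcube (by positivity : 0 ≤ R / 2) hψ0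
    (summable_of_ne_finset_zero (s := fourBoxes d N A) fun n hn => by simp [hψ, hn]) hψρ hn)
  ring

/-- High-to-low energy transfer: if the profile `φ` on the four boxes dominates the low-frequency
data, then at time `T` the solution is large on the low-frequency box. -/
theorem exists_solution_large (hd : 1 ≤ d) {N A : ℕ} (hA : 1 ≤ A) (hN : 6 * A ≤ N)
    {K R T M C : ℝ} (hK : 1 ≤ K) (hR : 0 < R) (hT : 0 < T) (hT1 : T ≤ 1)
    (hC : C = 4 * 5 ^ d) (hM : M = R * (A : ℝ) ^ d)
    (hTM : 5100 * C ^ 2 * (T * M) ≤ 1) (hMK : 32768 * K * C ≤ M) (hRM : 128 * K ^ 3 ≤ R * M ^ 2)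
    (hTN : 3 * (d + 1) * (T * N) ≤ 1) {U₀ U₁ φ : L1 d} (hU : ‖U₀‖ + ‖U₁‖ ≤ K)
    (hφ : φ = truncate (fourBoxes d N A) fun _ => (R : ℂ)) :
    ∃ u : ℝ → L1 d, Continuous u ∧
      (∀ t ∈ Icc 0 T, ∀ n, u t n = (Real.cos (t * jap n) : ℂ) * (U₀ + φ) n
        + ((Real.sin (t * jap n) / jap n : ℝ) : ℂ) * U₁ n
        - ∫ s in (0 : ℝ)..t, ((Real.sin ((t - s) * jap n) / jap n : ℝ) : ℂ)
            * tri (u s) (u s) (u s) n) ∧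
      ∀ n ∈ box d 0 A, U₀ n = 0 → U₁ n = 0 → (T * M) ^ 2 * R / 64 ≤ ‖u T n‖ := by
  have hC1 : 1 ≤ C := by
    have : (1 : ℝ) ≤ 5 ^ d := one_le_pow₀ (by norm_num)
    linarith
  obtain ⟨hTB, hTKM, hCM, hTY40, hTKR, herr⟩ := parameter_bounds hK hR hT hC1 hTM hMK hRM rfl
  have hC0 : 0 < C := by linarith
  have hM0 : 0 < M := by nlinarith
  have hφM : ‖φ‖ ≤ C * M := by
    rw [hφ]
    refine (norm_truncate_const_le _ hR.le).trans ?_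
    calc ((fourBoxes d N A).card : ℝ) * R ≤ 4 * 5 ^ d * (A : ℝ) ^ d * R := by
          gcongr; exact card_fourBoxes_le hA
      _ = C * M := by rw [hC, hM]; ring
  have hU₀ : ‖U₀‖ ≤ K := by linarith [norm_nonneg U₁]
  have hU₁ : ‖U₁‖ ≤ K := by linarith [norm_nonneg U₀]
  obtain ⟨u, huc, hub, hu⟩ := exists_solution (T := T) (B := 2 * (C * M)) hT (by positivity)
    hTB (U₀ + φ) U₁ ((norm_add_le _ _).trans (by linarith))
    ((mul_le_mul_of_nonneg_left hU₁ hT.le).trans hTKM)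
  refine ⟨u, huc, hu, fun n hn hn₀ hn₁ => ?_⟩
  have hφn : φ n = 0 := by
    rw [hφ, truncate_apply, if_neg (notMem_fourBoxes hd hA hN hn)]
  set Y : ℝ := 8 * (C * M) with hY
  have hKY : K ≤ Y := by linarith
  have hφY : ‖φ‖ ≤ Y := by linarith
  have hlow : ∀ s ∈ Icc 0 T, R * M ^ 2 / 16 ≤ (tri (u s) (u s) (u s) n).re := fun s hs => by
    have h1 := norm_tri_sub_tri_cosM_le (φ := φ) hT hT1 (K := K) (Y := Y) (R := R) hKY
      hTY40 hTKR hU hφY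
      (fun m => by
        rw [hφ, truncate_apply]; split_ifs
        · simp [abs_of_pos hR]
        · simpa using hR.le)
      (fun t ht => (hub t ht).trans (by rw [hY]; linarith)) hu hs n
    have h2 := le_re_tri_cosM hA hN hR.le hs.1 (le_trans (by gcongr; exact hs.2) hTN) hφ hn
    have h3 := (Complex.abs_re_le_norm _).trans (h1.trans herr)
    rw [Complex.sub_re] at h3
    rw [← hM] at h2
    linarith [(abs_le.1 h3).1]
  have hTn : T * jap n ≤ 1 := by
    have hA1 : (1 : ℝ) ≤ A := by exact_mod_cast hA
    have hAN : (A : ℝ) ≤ N := by exact_mod_cast (by omega : A ≤ N)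
    have h1 : jap n ≤ (d + 1) * A := jap_le hA1 fun i => by
      have := mem_box.1 hn i
      have h3 : |n i| ≤ A := abs_le.2 ⟨by linarith [this.1], by linarith [this.2]⟩
      exact_mod_cast h3
    have h2 : (d + 1) * (A : ℝ) ≤ (d + 1) * N := by gcongr
    have h4 : 0 ≤ ((d : ℝ) + 1) * N := by positivity
    nlinarith
  have hfc : Continuous fun s => tri (u s) (u s) (u s) n :=
    (eval n).continuous.comp (continuous_tri_self.comp huc)
  have := le_norm_duhamel hT.le hTn hfc (κ := R * M ^ 2 / 16) (by positivity) hlow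
  rw [hu T ⟨hT.le, le_rfl⟩ n, lp.coeFn_add, Pi.add_apply, hn₀, hn₁, hφn, add_zero, mul_zero,
    mul_zero, add_zero, zero_sub, norm_neg]
  exact le_trans (le_of_eq (by ring)) this

end L1

end Core

section Parameters

open Filter Topology

/-- The low-frequency mass `∑ ⟨n⟩^{2s}` over the cube of radius `A` minus the cube of radius `k`. -/
def lowMass (d k A : ℕ) (s : ℝ) : ℝ := ∑ n ∈ box d 0 A \ box d 0 k, jap n ^ (2 * s)

lemma tendsto_natCast_rpow {a : ℝ} (ha : 0 < a) :
    Tendsto (fun A : ℕ => (A : ℝ) ^ a) atTop atTop :=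
  (tendsto_rpow_atTop ha).comp tendsto_natCast_atTop_atTop

lemma tendsto_natCast_rpow_neg {a : ℝ} (ha : a < 0) :
    Tendsto (fun A : ℕ => (A : ℝ) ^ a) atTop (𝓝 0) := by
  have := (tendsto_rpow_neg_atTop (neg_pos.2 ha)).comp
    (tendsto_natCast_atTop_atTop (R := ℝ))
  simpa only [neg_neg, Function.comp_def] using this

lemma abs_le_of_mem_box {d A : ℕ} {n : Freq d} (hn : n ∈ box d 0 A) (i : Fin d) :
    |(n i : ℝ)| ≤ A := by
  have := mem_box.1 hn i
  have h3 : |n i| ≤ A := abs_le.2 ⟨by linarith [this.1], by linarith [this.2]⟩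
  exact_mod_cast h3

lemma le_lowMass {d : ℕ} (hd : 1 ≤ d) {s : ℝ} (hs : s < 0) {k A : ℕ} (hA : 2 * k + 1 ≤ A) :
    ((d : ℝ) + 1) ^ (2 * s) ≤ (A : ℝ) ^ (-(d : ℝ) - 2 * s) * lowMass d k A s := by
  have hA1 : (1 : ℝ) ≤ A := by exact_mod_cast (by omega : 1 ≤ A)
  have hA0 : (0 : ℝ) < A := by linarith
  have hd0 : (0 : ℝ) < (d : ℝ) + 1 := by positivity
  have hsub : box d 0 (k : ℤ) ⊆ box d 0 A := fun n hn => mem_box.2 fun i => by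
    have := mem_box.1 hn i; omega
  have hcard : A ^ d ≤ (box d 0 (A : ℤ) \ box d 0 k).card := by
    rw [Finset.card_sdiff_of_subset hsub, card_box, card_box]
    have h1 : A ^ d + (2 * k + 1) ^ d ≤ (A + (2 * k + 1)) ^ d :=
      pow_add_pow_le (by omega) (by omega) (by omega)
    have h2 : (A + (2 * k + 1)) ^ d ≤ (2 * A + 1) ^ d := Nat.pow_le_pow_left (by omega) d
    omega
  have hcard' : (A : ℝ) ^ d ≤ (box d 0 (A : ℤ) \ box d 0 k).card := by exact_mod_cast hcard
  have hsum : (A : ℝ) ^ d * (((d : ℝ) + 1) * A) ^ (2 * s) ≤ lowMass d k A s := by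
    calc (A : ℝ) ^ d * (((d : ℝ) + 1) * A) ^ (2 * s)
        ≤ (box d 0 (A : ℤ) \ box d 0 k).card * (((d : ℝ) + 1) * A) ^ (2 * s) := by gcongr
      _ = ∑ _n ∈ box d 0 (A : ℤ) \ box d 0 k, (((d : ℝ) + 1) * A) ^ (2 * s) := by
          rw [Finset.sum_const, nsmul_eq_mul]
      _ ≤ _ := Finset.sum_le_sum fun n hn => Real.rpow_le_rpow_of_nonpos (jap_pos n)
          (jap_le hA1 (abs_le_of_mem_box (Finset.mem_sdiff.1 hn).1)) (by linarith)
  calc ((d : ℝ) + 1) ^ (2 * s)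
      = (A : ℝ) ^ (-(d : ℝ) - 2 * s) * ((A : ℝ) ^ d * (((d : ℝ) + 1) * A) ^ (2 * s)) := by
        rw [Real.mul_rpow hd0.le hA0.le, ← Real.rpow_natCast (A : ℝ) d, mul_left_comm _ _ (_ ^ _),
          mul_left_comm, ← Real.rpow_add hA0, ← Real.rpow_add hA0]
        ring_nf
        simp
    _ ≤ _ := by gcongr

lemma tendsto_lowMass_one {s : ℝ} (hs : s ≤ -(1 / 2)) (k : ℕ) :
    Tendsto (fun A : ℕ => (A : ℝ) ^ (-(1 : ℝ) - 2 * s) * lowMass 1 k A s) atTop atTop := by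
  have hH : Tendsto (fun A : ℕ => ∑ j ∈ Finset.range A, 1 / ((j : ℝ) + 1)) atTop atTop :=
    Real.tendsto_sum_range_one_div_nat_succ_atTop
  have hH' : Tendsto (fun A : ℕ => (2 : ℝ) ^ (2 * s) *
      (∑ j ∈ Finset.range A, 1 / ((j : ℝ) + 1) - ∑ j ∈ Finset.range k, 1 / ((j : ℝ) + 1)))
      atTop atTop :=
    (tendsto_atTop_add_const_right _ _ hH).const_mul_atTop (by positivity)
  refine tendsto_atTop_mono' _ ?_ hH'
  filter_upwards [eventually_ge_atTop k, eventually_ge_atTop 1] with A hA hA1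
  have hA0 : (0 : ℝ) < A := by exact_mod_cast hA1
  rw [← Finset.sum_range_add_sum_Ico _ hA, add_sub_cancel_left, Finset.mul_sum, lowMass,
    Finset.mul_sum]
  set g : ℕ → Freq 1 := fun j _ => (j : ℤ) + 1 with hg
  have hinj : Set.InjOn g (Finset.Ico k A) := fun i _ j _ h => by
    have := congrFun h 0
    simp only [hg] at this
    omega
  calc ∑ j ∈ Finset.Ico k A, (2 : ℝ) ^ (2 * s) * (1 / ((j : ℝ) + 1))
      ≤ ∑ j ∈ Finset.Ico k A, (A : ℝ) ^ (-(1 : ℝ) - 2 * s) * jap (g j) ^ (2 * s) := by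
        refine Finset.sum_le_sum fun j hj => ?_
        have hj0 : (0 : ℝ) < (j : ℝ) + 1 := by positivity
        have hjA : (j : ℝ) + 1 ≤ A := by exact_mod_cast (Finset.mem_Ico.1 hj).2
        have h1 : jap (g j) ≤ 2 * ((j : ℝ) + 1) := by
          have := jap_le (n := g j) (X := (j : ℝ) + 1)
            (by linarith [(Nat.cast_nonneg j : (0 : ℝ) ≤ j)]) fun i => by
              simp only [hg]; push_cast; rw [abs_of_pos hj0]
          norm_num at this
          exact this
        have h2 : (2 * ((j : ℝ) + 1)) ^ (2 * s) ≤ jap (g j) ^ (2 * s) :=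
          Real.rpow_le_rpow_of_nonpos (jap_pos _) h1 (by linarith)
        have h3 : ((j : ℝ) + 1) ^ (-(1 : ℝ) - 2 * s) ≤ (A : ℝ) ^ (-(1 : ℝ) - 2 * s) :=
          Real.rpow_le_rpow hj0.le hjA (by linarith)
        calc (2 : ℝ) ^ (2 * s) * (1 / ((j : ℝ) + 1))
            = ((j : ℝ) + 1) ^ (-(1 : ℝ) - 2 * s) * (2 * ((j : ℝ) + 1)) ^ (2 * s) := by
              rw [Real.mul_rpow (by norm_num) hj0.le, mul_left_comm, ← Real.rpow_add hj0,
                show -(1 : ℝ) - 2 * s + 2 * s = -1 by ring, Real.rpow_neg_one, one_div]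
          _ ≤ _ := by gcongr
    _ = ∑ n ∈ (Finset.Ico k A).image g, (A : ℝ) ^ (-(1 : ℝ) - 2 * s) * jap n ^ (2 * s) := by
        rw [Finset.sum_image hinj]
    _ ≤ _ := by
        refine Finset.sum_le_sum_of_subset_of_nonneg (fun n hn => ?_) fun n _ _ => by
          have := jap_pos n
          positivity
        obtain ⟨j, hj, rfl⟩ := Finset.mem_image.1 hn
        have := Finset.mem_Ico.1 hj
        refine Finset.mem_sdiff.2 ⟨mem_box.2 fun i => ?_, fun h => ?_⟩
        · simp only [hg]; omega
        · have := mem_box.1 h 0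
          simp only [hg] at this
          omega

/-- The shape of the smallness and largeness requirements, reduced to asymptotics in `A` with the
ratio `L = N / A` fixed. -/
lemma exists_parameters_of_eventually {d : ℕ} {s : ℝ} (hs : s < 0) {C η K Λ ε δ : ℝ} {L k : ℕ}
    (hη : 0 < η) (hε : 0 < ε) (hδ : 0 < δ) (hL : 6 ≤ L)
    (hδC : 5100 * C ^ 2 * δ ≤ 1)
    (hTN : ∀ᶠ A : ℕ in atTop,
      3 * ((d : ℝ) + 1) * (δ / η * (L : ℝ) ^ (1 + s) * (A : ℝ) ^ (1 - (d : ℝ) / 2 + s)) ≤ 1)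
    (hΛ : ∀ᶠ A : ℕ in atTop, Λ < δ ^ 4 * η ^ 2 / 4096 * (L : ℝ) ^ (-2 * s) *
      ((A : ℝ) ^ (-(d : ℝ) - 2 * s) * lowMass d k A s)) :
    ∃ (A N : ℕ) (R T M : ℝ), 1 ≤ A ∧ 6 * A ≤ N ∧ 0 < R ∧ 0 < T ∧ T ≤ 1 ∧ T < ε ∧
      M = R * (A : ℝ) ^ d ∧ 5100 * C ^ 2 * (T * M) ≤ 1 ∧ 32768 * K * C ≤ M ∧
      128 * K ^ 3 ≤ R * M ^ 2 ∧ 3 * ((d : ℝ) + 1) * (T * N) ≤ 1 ∧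
      R ^ 2 * (A : ℝ) ^ d * (N : ℝ) ^ (2 * s) = η ^ 2 ∧
      Λ < ((T * M) ^ 2 * R / 64) ^ 2 * lowMass d k A s := by
  have hL0 : (0 : ℝ) < L := by exact_mod_cast (by omega : 0 < L)
  set c : ℝ := η * (L : ℝ) ^ (-s) with hc
  have hc0 : 0 < c := by positivity
  have hd0 : (0 : ℝ) ≤ d := Nat.cast_nonneg d
  have hMt : Tendsto (fun A : ℕ => c * (A : ℝ) ^ ((d : ℝ) / 2 - s)) atTop atTop :=
    (tendsto_natCast_rpow (by linarith)).const_mul_atTop hc0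
  have hRt : Tendsto (fun A : ℕ => c ^ 3 * (A : ℝ) ^ ((d : ℝ) / 2 - 3 * s)) atTop atTop :=
    (tendsto_natCast_rpow (by linarith)).const_mul_atTop (by positivity)
  obtain ⟨A, hA1, hTNA, hΛA, hM1, hM2, hM3, hR1⟩ := ((eventually_ge_atTop 1).and <| hTN.and <|
    hΛ.and <| (hMt.eventually_ge_atTop (32768 * K * C)).and <| (hMt.eventually_ge_atTop δ).and <|
    (hMt.eventually_gt_atTop (δ / ε)).and <| hRt.eventually_ge_atTop (128 * K ^ 3)).exists
  have hA0 : (0 : ℝ) < A := by exact_mod_cast hA1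
  set M : ℝ := c * (A : ℝ) ^ ((d : ℝ) / 2 - s) with hM
  set R : ℝ := c * (A : ℝ) ^ (-(d : ℝ) / 2 - s) with hR
  have hM0 : 0 < M := by positivity
  have hR0 : 0 < R := by positivity
  have hpow : (A : ℝ) ^ d = (A : ℝ) ^ (d : ℝ) := (Real.rpow_natCast _ _).symm
  have hsq : ∀ a : ℝ, ((A : ℝ) ^ a) ^ 2 = (A : ℝ) ^ (2 * a) := fun a => by
    rw [mul_comm, Real.rpow_mul hA0.le, ← Real.rpow_natCast]; norm_num
  have hsqL : ((L : ℝ) ^ (-s)) ^ 2 = (L : ℝ) ^ (-2 * s) := by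
    rw [← Real.rpow_natCast, ← Real.rpow_mul hL0.le]; congr 1; push_cast; ring
  have hMR : M = R * (A : ℝ) ^ d := by
    calc M = c * (A : ℝ) ^ (-(d : ℝ) / 2 - s + d) := by rw [hM]; congr 2; ring
      _ = R * (A : ℝ) ^ d := by rw [Real.rpow_add hA0, hpow, hR]; ring
  have hTM : δ / M * M = δ := div_mul_cancel₀ _ hM0.ne'
  refine ⟨A, L * A, R, δ / M, M, hA1, Nat.mul_le_mul_right A hL, hR0, by positivity,
    (div_le_one hM0).2 hM2, (div_lt_comm₀ hM0 hε).2 hM3, hMR, by rwa [hTM], hM1, ?_, ?_, ?_, ?_⟩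
  · refine hR1.trans (le_of_eq ?_)
    calc c ^ 3 * (A : ℝ) ^ ((d : ℝ) / 2 - 3 * s)
        = c ^ 3 * ((A : ℝ) ^ (-(d : ℝ) / 2 - s) * (A : ℝ) ^ (2 * ((d : ℝ) / 2 - s))) := by
          rw [← Real.rpow_add hA0]; congr 2; ring
      _ = R * M ^ 2 := by rw [← hsq, hR, hM]; ring
  · refine (le_of_eq ?_).trans hTNA
    have h1 : (L : ℝ) ^ (1 + s) * (L : ℝ) ^ (-s) = L := by
      rw [← Real.rpow_add hL0]; norm_num
    have h2 : (A : ℝ) ^ (1 - (d : ℝ) / 2 + s) * (A : ℝ) ^ ((d : ℝ) / 2 - s) = A := by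
      rw [← Real.rpow_add hA0, show 1 - (d : ℝ) / 2 + s + ((d : ℝ) / 2 - s) = 1 by ring,
        Real.rpow_one]
    congr 1
    rw [div_mul_eq_mul_div, div_eq_iff hM0.ne', hM, hc]
    push_cast
    calc δ * ((L : ℝ) * A) = δ * (((L : ℝ) ^ (1 + s) * (L : ℝ) ^ (-s)) *
          ((A : ℝ) ^ (1 - (d : ℝ) / 2 + s) * (A : ℝ) ^ ((d : ℝ) / 2 - s))) := by rw [h1, h2]
      _ = _ := by field_simp
  · push_cast
    rw [hR, mul_pow, hsq, hpow, Real.mul_rpow hL0.le hA0.le, hc, mul_pow, hsqL]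
    calc _ = η ^ 2 * ((L : ℝ) ^ (-2 * s) * (L : ℝ) ^ (2 * s)) *
          ((A : ℝ) ^ (2 * (-(d : ℝ) / 2 - s)) * (A : ℝ) ^ (d : ℝ) * (A : ℝ) ^ (2 * s)) := by ring
      _ = _ := by
        rw [← Real.rpow_add hL0, ← Real.rpow_add hA0, ← Real.rpow_add hA0]
        ring_nf
        simp
  · refine hΛA.trans_eq ?_
    rw [hTM, hR, hc]
    calc _ = δ ^ 4 * η ^ 2 / 4096 * ((L : ℝ) ^ (-s)) ^ 2 *
          (((A : ℝ) ^ (-(d : ℝ) / 2 - s)) ^ 2 * lowMass d k A s) := by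
          rw [hsqL, hsq, show 2 * (-(d : ℝ) / 2 - s) = -(d : ℝ) - 2 * s by ring]
      _ = _ := by ring

lemma exists_parameters {d : ℕ} (hd : 1 ≤ d) {s : ℝ} (hs : s < 0) (hd1 : d = 1 → s ≤ -(1 / 2))
    {C η ε : ℝ} (hC : 0 < C) (hη : 0 < η) (hε : 0 < ε) (K Λ : ℝ) (k : ℕ) :
    ∃ (A N : ℕ) (R T M : ℝ), 1 ≤ A ∧ 6 * A ≤ N ∧ 0 < R ∧ 0 < T ∧ T ≤ 1 ∧ T < ε ∧
      M = R * (A : ℝ) ^ d ∧ 5100 * C ^ 2 * (T * M) ≤ 1 ∧ 32768 * K * C ≤ M ∧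
      128 * K ^ 3 ≤ R * M ^ 2 ∧ 3 * ((d : ℝ) + 1) * (T * N) ≤ 1 ∧
      R ^ 2 * (A : ℝ) ^ d * (N : ℝ) ^ (2 * s) = η ^ 2 ∧
      Λ < ((T * M) ^ 2 * R / 64) ^ 2 * lowMass d k A s := by
  set δ : ℝ := min (1 / (5100 * C ^ 2)) (η / 36) with hδ
  have hδ0 : 0 < δ := lt_min (by positivity) (by positivity)
  have hδC : 5100 * C ^ 2 * δ ≤ 1 := by
    calc 5100 * C ^ 2 * δ ≤ 5100 * C ^ 2 * (1 / (5100 * C ^ 2)) := by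
          gcongr; exact min_le_left _ _
      _ = 1 := by field_simp
  rcases hd.eq_or_lt with rfl | hd2
  · have hs' := hd1 rfl
    refine exists_parameters_of_eventually (L := 6) hs hη hε hδ0 le_rfl hδC ?_ ?_
    · filter_upwards [eventually_ge_atTop 1] with A hA
      have hA1 : (1 : ℝ) ≤ A := by exact_mod_cast hA
      have h1 : (A : ℝ) ^ (1 - ((1 : ℕ) : ℝ) / 2 + s) ≤ 1 :=
        Real.rpow_le_one_of_one_le_of_nonpos hA1 (by push_cast; linarith)
      have h2 : ((6 : ℕ) : ℝ) ^ (1 + s) ≤ 6 := by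
        calc ((6 : ℕ) : ℝ) ^ (1 + s) ≤ ((6 : ℕ) : ℝ) ^ (1 : ℝ) :=
              Real.rpow_le_rpow_of_exponent_le (by norm_num) (by linarith)
          _ = 6 := by norm_num
      have h3 : δ / η ≤ 1 / 36 := by
        rw [div_le_iff₀ hη]; linarith [min_le_right (1 / (5100 * C ^ 2)) (η / 36)]
      calc _ ≤ 3 * (((1 : ℕ) : ℝ) + 1) * (1 / 36 * 6 * 1) := by gcongr
        _ ≤ 1 := by norm_num
    · have := (tendsto_lowMass_one hs' k).const_mul_atTop
        (by positivity : 0 < δ ^ 4 * η ^ 2 / 4096 * ((6 : ℕ) : ℝ) ^ (-2 * s))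
      simpa using this.eventually_gt_atTop Λ
  · have hd2' : (2 : ℝ) ≤ d := by exact_mod_cast hd2
    have hLt : Tendsto (fun L : ℕ => δ ^ 4 * η ^ 2 / 4096 * ((d : ℝ) + 1) ^ (2 * s) *
        (L : ℝ) ^ (-2 * s)) atTop atTop :=
      (tendsto_natCast_rpow (by linarith)).const_mul_atTop (by positivity)
    obtain ⟨L, hL6, hL⟩ := ((eventually_ge_atTop 6).and (hLt.eventually_gt_atTop Λ)).exists
    refine exists_parameters_of_eventually (L := L) hs hη hε hδ0 hL6 hδC ?_ ?_
    · have := ((tendsto_natCast_rpow_neg (a := 1 - (d : ℝ) / 2 + s) (by linarith)).const_mul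
        (δ / η * (L : ℝ) ^ (1 + s))).const_mul (3 * ((d : ℝ) + 1))
      simp only [mul_zero] at this
      exact this.eventually_le_const one_pos
    · filter_upwards [eventually_ge_atTop (2 * k + 1)] with A hA
      calc Λ < _ := hL
        _ = δ ^ 4 * η ^ 2 / 4096 * (L : ℝ) ^ (-2 * s) * ((d : ℝ) + 1) ^ (2 * s) := by ring
        _ ≤ _ := by gcongr; exact le_lowMass hd hs hA

end Parameters

section Sobolev

variable {d : ℕ}

lemma exists_box_tail_lt {f : Freq d → ℝ} (hf : Summable f) {r : ℝ} (hr : 0 < r) :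
    ∃ k₀ : ℕ, ∀ k : ℕ, k₀ ≤ k → ∑' n, (if n ∈ box d 0 k then 0 else f n) < r := by
  obtain ⟨S, hS⟩ := summable_iff_vanishing_norm.1 hf (r / 2) (half_pos hr)
  refine ⟨S.sup fun n => Finset.univ.sup fun i => (n i).natAbs, fun k hk => ?_⟩
  refine lt_of_le_of_lt (tsum_le_of_sum_le' (half_pos hr).le fun F => ?_) (half_lt_self hr)
  have hsub : S ⊆ box d 0 k := fun n hn => mem_box.2 fun i => by
    have h1 : (n i).natAbs ≤ k := ((Finset.le_sup (f := fun i => (n i).natAbs)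
      (Finset.mem_univ i)).trans (Finset.le_sup (f := fun n : Freq d =>
        Finset.univ.sup fun i => (n i).natAbs) hn)).trans hk
    omega
  calc ∑ n ∈ F, (if n ∈ box d 0 (k : ℤ) then 0 else f n)
      = ∑ n ∈ F \ box d 0 k, f n := by
        rw [← Finset.filter_notMem_eq_sdiff, Finset.sum_filter]
        exact Finset.sum_congr rfl fun n _ => by split_ifs <;> rfl
    _ ≤ r / 2 := (Real.le_norm_self _).trans
        (hS _ (Finset.disjoint_of_subset_right hsub Finset.sdiff_disjoint)).le

lemma summable_sobolev {σ : ℝ} (hσ : σ ≤ 0) (x : L1 d) :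
    Summable fun n => jap n ^ (2 * σ) * ‖x n‖ ^ 2 := by
  refine Summable.of_nonneg_of_le (fun n => ?_) (fun n => ?_) (x.summable_norm.mul_left ‖x‖)
  · have := jap_pos n
    positivity
  · have h1 : jap n ^ (2 * σ) ≤ 1 :=
      Real.rpow_le_one_of_one_le_of_nonpos (one_le_jap n) (by linarith)
    have h2 := x.norm_apply_le n
    have h3 := norm_nonneg (x n)
    calc jap n ^ (2 * σ) * ‖x n‖ ^ 2 ≤ 1 * (‖x‖ * ‖x n‖) := by
          rw [sq]; gcongr
      _ = _ := one_mul _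

lemma L1.solvesNLW {T : ℝ} {v₀ v₁ : L1 d} {u : ℝ → L1 d} (huc : Continuous u)
    (hu : ∀ t ∈ Icc 0 T, ∀ n, u t n = (Real.cos (t * jap n) : ℂ) * v₀ n
      + ((Real.sin (t * jap n) / jap n : ℝ) : ℂ) * v₁ n
      - ∫ s in (0 : ℝ)..t, ((Real.sin ((t - s) * jap n) / jap n : ℝ) : ℂ)
          * tri (u s) (u s) (u s) n) :
    SolvesNLW (Icc 0 T) v₀ v₁ fun t => u t := by
  refine ⟨⟨fun t _ => (u t).summable_norm, fun t _ ε hε => ?_⟩, hu⟩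
  obtain ⟨δ, hδ, h⟩ := Metric.continuous_iff.1 huc t ε hε
  refine ⟨δ, hδ, fun s _ hst => ?_⟩
  have := h s (by rwa [Real.dist_eq])
  rw [dist_eq_norm, norm_eq_tsum] at this
  simpa using this

/-- Removing the frequencies of a finite set and adding a profile supported on the four boxes
perturbs a sequence by the tail and the mass of the profile. -/
lemma hsum_truncate_add_sub_le {σ : ℝ} (hσ : σ ≤ 0) {f : Freq d → ℂ}
    (hf : Summable fun n => jap n ^ (2 * σ) * ‖f n‖ ^ 2) (S : Finset (Freq d)) (φ : L1 d) :
    (Summable fun n => jap n ^ (2 * σ) * ‖(L1.truncate S f + φ) n - f n‖ ^ 2) ∧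
      hsum σ (fun n => (L1.truncate S f + φ) n - f n) ≤
        2 * hsum σ φ + 2 * ∑' n, (if n ∈ S then 0 else jap n ^ (2 * σ) * ‖f n‖ ^ 2) := by
  have hφ := summable_sobolev hσ φ
  have htail : Summable fun n => if n ∈ S then 0 else jap n ^ (2 * σ) * ‖f n‖ ^ 2 := by
    refine Summable.of_nonneg_of_le (fun n => ?_) (fun n => ?_) hf <;>
    · have := jap_pos n
      split_ifs <;> first | positivity | exact le_rfl
  have hle : ∀ n, jap n ^ (2 * σ) * ‖(L1.truncate S f + φ) n - f n‖ ^ 2 ≤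
      2 * (jap n ^ (2 * σ) * ‖φ n‖ ^ 2)
        + 2 * (if n ∈ S then 0 else jap n ^ (2 * σ) * ‖f n‖ ^ 2) := fun n => by
    have hj : 0 ≤ jap n ^ (2 * σ) := Real.rpow_nonneg (jap_pos n).le _
    rw [lp.coeFn_add, Pi.add_apply, L1.truncate_apply]
    split_ifs with h
    · rw [add_sub_cancel_left]
      have : 0 ≤ jap n ^ (2 * σ) * ‖φ n‖ ^ 2 := by positivity
      linarith
    · have h1 : ‖0 + φ n - f n‖ ≤ ‖φ n‖ + ‖f n‖ := by rw [zero_add]; exact norm_sub_le _ _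
      have h2 : ‖0 + φ n - f n‖ ^ 2 ≤ 2 * ‖φ n‖ ^ 2 + 2 * ‖f n‖ ^ 2 := by
        nlinarith [norm_nonneg (0 + φ n - f n), sq_nonneg (‖φ n‖ - ‖f n‖)]
      nlinarith
  have hs := (hφ.mul_left 2).add (htail.mul_left 2)
  have hsum' := Summable.of_nonneg_of_le
    (fun n => mul_nonneg (Real.rpow_nonneg (jap_pos n).le _) (sq_nonneg _)) hle hs
  refine ⟨hsum', (hsum'.tsum_le_tsum hle hs).trans (le_of_eq ?_)⟩
  rw [(hφ.mul_left 2).tsum_add (htail.mul_left 2), tsum_mul_left, tsum_mul_left]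
  rfl

lemma hsum_fourBoxes_le (hd : 1 ≤ d) {σ : ℝ} (hσ : σ ≤ 0) {N A : ℕ} (hA : 1 ≤ A) (hN : 6 * A ≤ N)
    (R : ℝ) : hsum σ (L1.truncate (fourBoxes d N A) fun _ => (R : ℂ)) ≤
      4 * 5 ^ d * 2⁻¹ ^ (2 * σ) * (R ^ 2 * (A : ℝ) ^ d * (N : ℝ) ^ (2 * σ)) := by
  have hN0 : (0 : ℝ) < N := by exact_mod_cast (by omega : 0 < N)
  rw [hsum, tsum_eq_sum (s := fourBoxes d N A) fun n hn => by simp [L1.truncate_apply, hn]]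
  calc _ ≤ ∑ _n ∈ fourBoxes d N A, ((N : ℝ) / 2) ^ (2 * σ) * R ^ 2 :=
        Finset.sum_le_sum fun n hn => by
          rw [L1.truncate_apply, if_pos hn, Complex.norm_real, Real.norm_eq_abs, sq_abs]
          gcongr ?_ * _
          exact Real.rpow_le_rpow_of_nonpos (by positivity) (le_jap_of_mem_fourBoxes hd hN hn)
            (by linarith)
    _ = (fourBoxes d N A).card * (((N : ℝ) / 2) ^ (2 * σ) * R ^ 2) := by
        rw [Finset.sum_const, nsmul_eq_mul]
    _ ≤ 4 * 5 ^ d * (A : ℝ) ^ d * (((N : ℝ) / 2) ^ (2 * σ) * R ^ 2) := by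
        gcongr; exact card_fourBoxes_le hA
    _ = _ := by rw [div_eq_mul_inv, Real.mul_rpow hN0.le (by norm_num)]; ring

lemma mul_lowMass_le_hsum {σ : ℝ} (hσ : σ ≤ 0) (x : L1 d) {k A : ℕ} {r : ℝ} (hr : 0 ≤ r)
    (hx : ∀ n ∈ box d 0 (A : ℤ) \ box d 0 k, r ≤ ‖x n‖) :
    r ^ 2 * lowMass d k A σ ≤ hsum σ x := by
  refine le_trans ?_ ((summable_sobolev hσ x).sum_le_tsum (box d 0 (A : ℤ) \ box d 0 k)
    fun n _ => mul_nonneg (Real.rpow_nonneg (jap_pos n).le _) (sq_nonneg _))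
  rw [lowMass, Finset.mul_sum]
  refine Finset.sum_le_sum fun n hn => ?_
  rw [mul_comm]
  exact mul_le_mul_of_nonneg_left (pow_le_pow_left₀ hr (hx n hn) 2)
    (Real.rpow_nonneg (jap_pos n).le _)

end Sobolev

end

/-- Norm inflation at every initial datum for the cubic NLW on `𝕋^d`
in `H^s × H^{s-1}` for `s < 0` (with additionally `s ≤ -1/2` when `d = 1`). -/
theorem nlw_norm_inflation_general_data (d : ℕ) (hd : 1 ≤ d) (s : ℝ) (hs : s < 0)
    (hd1 : d = 1 → s ≤ -(1 / 2))
    (u₀ u₁ : (Fin d → ℤ) → ℂ)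
    (hreal₀ : ∀ n, u₀ (-n) = starRingEnd ℂ (u₀ n))
    (hreal₁ : ∀ n, u₁ (-n) = starRingEnd ℂ (u₁ n))
    (hfin₀ : Summable fun n => (jap n) ^ (2 * s) * ‖u₀ n‖ ^ 2)
    (hfin₁ : Summable fun n => (jap n) ^ (2 * (s - 1)) * ‖u₁ n‖ ^ 2) :
    ∀ ε > (0 : ℝ), ∃ (v₀ v₁ : (Fin d → ℤ) → ℂ) (tε : ℝ) (u : ℝ → (Fin d → ℤ) → ℂ),
      (∀ n, v₀ (-n) = starRingEnd ℂ (v₀ n)) ∧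
      (∀ n, v₁ (-n) = starRingEnd ℂ (v₁ n)) ∧
      Summable (fun n => ‖v₀ n‖ + (jap n)⁻¹ * ‖v₁ n‖) ∧
      0 < tε ∧ tε < ε ∧
      SolvesNLW (Set.Icc 0 tε) v₀ v₁ u ∧
      Summable (fun n => (jap n) ^ (2 * s) * ‖v₀ n - u₀ n‖ ^ 2) ∧
      Summable (fun n => (jap n) ^ (2 * (s - 1)) * ‖v₁ n - u₁ n‖ ^ 2) ∧
      Real.sqrt (hsum s (fun n => v₀ n - u₀ n) + hsum (s - 1) (fun n => v₁ n - u₁ n)) < ε ∧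
      Real.sqrt (hsum s (u tε)) > 1 / ε := by
  intro ε hε
  obtain ⟨k₀, hk₀⟩ := exists_box_tail_lt hfin₀ (show 0 < ε ^ 2 / 8 by positivity)
  obtain ⟨k₁, hk₁⟩ := exists_box_tail_lt hfin₁ (show 0 < ε ^ 2 / 8 by positivity)
  obtain ⟨k, hk₀k, hk₁k⟩ : ∃ k, k₀ ≤ k ∧ k₁ ≤ k := ⟨max k₀ k₁, le_max_left _ _, le_max_right _ _⟩
  set C : ℝ := 4 * 5 ^ d with hC
  have hC0 : 0 < C := by positivity
  set D : ℝ := C * 2⁻¹ ^ (2 * s) with hD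
  have hD0 : 0 < D := by positivity
  set η : ℝ := ε / (4 * Real.sqrt D) with hη
  have hη0 : 0 < η := by positivity
  have hηD : D * η ^ 2 = ε ^ 2 / 16 := by
    rw [hη, div_pow, mul_pow, Real.sq_sqrt hD0.le]; field_simp; norm_num
  set U₀ : L1 d := L1.truncate (box d 0 k) u₀ with hU₀
  set U₁ : L1 d := L1.truncate (box d 0 k) u₁ with hU₁
  obtain ⟨A, N, R, T, M, hA, hN, hR, hT, hT1, hTε, hM, hTM, hMK, hRM, hTN, hRη, hΛ⟩ :=
    exists_parameters hd hs hd1 hC0 hη0 hε (‖U₀‖ + ‖U₁‖ + 1) ((1 / ε) ^ 2) k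
  set φ : L1 d := L1.truncate (fourBoxes d N A) fun _ => (R : ℂ) with hφ
  obtain ⟨u, huc, hu, hlarge⟩ := L1.exists_solution_large hd hA hN
    (le_add_of_nonneg_left (add_nonneg (norm_nonneg U₀) (norm_nonneg U₁))) hR hT hT1 hC hM hTM hMK
    hRM hTN (le_add_of_nonneg_right zero_le_one) hφ
  have hbox : ∀ n, -n ∈ box d 0 (k : ℤ) ↔ n ∈ box d 0 (k : ℤ) := fun n => by
    rw [neg_mem_box, neg_zero]
  obtain ⟨hsum₀, hle₀⟩ := hsum_truncate_add_sub_le hs.le hfin₀ (box d 0 k) φ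
  obtain ⟨hsum₁, hle₁⟩ := hsum_truncate_add_sub_le (by linarith) hfin₁ (box d 0 k) 0
  rw [add_zero, ← hU₁] at hsum₁ hle₁
  rw [← hU₀] at hsum₀ hle₀
  refine ⟨⇑(U₀ + φ), U₁, T, fun t => u t, fun n => ?_, L1.truncate_neg hbox hreal₁, ?_, hT, hTε,
    L1.solvesNLW huc hu, hsum₀, hsum₁, ?_, ?_⟩
  · rw [lp.coeFn_add, Pi.add_apply, Pi.add_apply, map_add, hU₀, L1.truncate_neg hbox hreal₀, hφ,
      L1.truncate_neg (fun n => neg_mem_fourBoxes) fun n => (Complex.conj_ofReal R).symm]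
  · refine (U₀ + φ).summable_norm.add (Summable.of_nonneg_of_le (fun n => ?_) (fun n => ?_)
      U₁.summable_norm)
    · have := jap_pos n
      positivity
    · exact mul_le_of_le_one_left (norm_nonneg _) (inv_le_one_of_one_le₀ (one_le_jap n))
  · rw [Real.sqrt_lt' hε]
    have h1 := hsum_fourBoxes_le hd hs.le hA hN R
    rw [hRη, ← hC, ← hD, hηD] at h1
    have h2 : hsum (s - 1) (⇑(0 : L1 d)) = 0 := by simp [hsum]
    rw [h2] at hle₁
    linarith [hk₀ k hk₀k, hk₁ k hk₁k, sq_pos_of_pos hε]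
  · refine Real.lt_sqrt_of_sq_lt (hΛ.trans_le (mul_lowMass_le_hsum hs.le (u T) (by positivity)
      fun n hn => ?_))
    rw [Finset.mem_sdiff] at hn
    exact hlarge n hn.1 (by rw [hU₀, L1.truncate_apply, if_neg hn.2])
      (by rw [hU₁, L1.truncate_apply, if_neg hn.2])
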